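/- arXiv:2510.19147 — 3 statements merged into one kernel-verified Lean document; each statement's English description precedes it below -/
import Mathlib

section
/- Let A ⊆ ℕ and let f be a uniformly e-invariant function defined on the enumeration-equivalence class deg_e(A) of A, taking values in P(ℕ). If f is not constant on deg_e(A), then A ≤_e f(A) or A^⋄ ≤_e f(A). -/
open Classical

/-- The `e`-th computably enumerable subset of `ℕ` (the domain of the `e`-th
partial computable function). -/
def ceSet (e : ℕ) : Set ℕ :=
  {n | ((Denumerable.ofNat Nat.Partrec.Code e).eval n).Dom}

/-- The finite set canonically coded by `u` (via binary expansion). -/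
def finCode (u : ℕ) : Set ℕ := {n | Nat.testBit u n}

/-- The `i`-th enumeration operator applied to `B`. -/
def eOp (i : ℕ) (B : Set ℕ) : Set ℕ :=
  {n | ∃ u : ℕ, Nat.pair n u ∈ ceSet i ∧ finCode u ⊆ B}

/-- `A ≤ₑ B` via the index `i`. -/
def ELeVia (A B : Set ℕ) (i : ℕ) : Prop := A = eOp i B

/-- Enumeration reducibility. -/
def ELe (A B : Set ℕ) : Prop := ∃ i, ELeVia A B i

/-- `A ≡ₑ B` via the pair of indices `⟨i,j⟩`. -/
def EEquivVia (A B : Set ℕ) (i j : ℕ) : Prop := ELeVia A B i ∧ ELeVia B A j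

/-- Enumeration equivalence. -/
def EEquiv (A B : Set ℕ) : Prop := ELe A B ∧ ELe B A

/-- Strict enumeration reducibility. -/
def ELt (A B : Set ℕ) : Prop := ELe A B ∧ ¬ ELe B A

/-- The enumeration degree of `A`, i.e. its `≡ₑ`-class. -/
def edeg (A : Set ℕ) : Set (Set ℕ) := {B | EEquiv A B}

/-- `K_A = {⟨i,n⟩ : n ∈ Γ_i(A)}`. -/
def KSet (A : Set ℕ) : Set ℕ := {m | m.unpair.2 ∈ eOp m.unpair.1 A}

/-- The skip `A^⋄ = ℕ \ K_A`. -/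
def eSkip (A : Set ℕ) : Set ℕ := (KSet A)ᶜ

/-- `A ⊕ B = {2n : n ∈ A} ∪ {2n+1 : n ∈ B}`. -/
def eJoin (A B : Set ℕ) : Set ℕ :=
  {n | (∃ m ∈ A, n = 2 * m) ∨ (∃ m ∈ B, n = 2 * m + 1)}

/-- The enumeration jump `A' = K_A ⊕ (ℕ \ K_A)`. -/
def eJump (A : Set ℕ) : Set ℕ := eJoin (KSet A) (KSet A)ᶜ

/-- `u` is a uniformity function for `f` on the domain `D`. -/
def IsUniformityOn (D : Set (Set ℕ)) (f : Set ℕ → Set ℕ) (u : ℕ → ℕ) : Prop :=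
  ∀ A ∈ D, ∀ B ∈ D, ∀ i j : ℕ, EEquivVia A B i j →
    EEquivVia (f A) (f B) (u (Nat.pair i j)).unpair.1 (u (Nat.pair i j)).unpair.2

/-- `f` is uniformly e-invariant on the domain `D`. -/
def UniformlyEInvariantOn (D : Set (Set ℕ)) (f : Set ℕ → Set ℕ) : Prop :=
  ∃ u : ℕ → ℕ, IsUniformityOn D f u

/-- `f` is uniformly e-invariant. -/
def UniformlyEInvariant (f : Set ℕ → Set ℕ) : Prop :=
  UniformlyEInvariantOn Set.univ f

/-- `f` is e-invariant. -/
def EInvariant (f : Set ℕ → Set ℕ) : Prop :=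
  ∀ A B : Set ℕ, EEquiv A B → EEquiv (f A) (f B)

/-- `f ≤ₑ^▽ g`: `f` is e-below `g` on a cone. -/
def ConeLe (f g : Set ℕ → Set ℕ) : Prop :=
  ∃ D : Set ℕ, ∀ X : Set ℕ, ELe D X → ELe (f X) (g X)

/-- Borel functions on Cantor space `P(ℕ)`. -/
def BorelFun (F : Set ℕ → Set ℕ) : Prop := Measurable F

/-! ## Primitive recursive preliminaries -/

namespace LocUMC

theorem primrec_testBit : PrimrecRel (fun u n : ℕ => Nat.testBit u n = true) := by
  have hpow : Primrec₂ (fun a b : ℕ => a ^ b) := Primrec₂.unpaired'.1 Nat.Primrec.pow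
  have h : PrimrecRel (fun u n : ℕ => u / 2 ^ n % 2 = 1) :=
    PrimrecRel.comp Primrec.eq
      (Primrec.nat_mod.comp
        (Primrec.nat_div.comp Primrec.fst (hpow.comp (Primrec.const 2) Primrec.snd))
        (Primrec.const 2))
      (Primrec.const 1)
  refine h.of_eq fun u n => ?_
  rw [Nat.testBit_eq_decide_div_mod_eq]
  simp

section
variable {α : Type} [Primcodable α]

theorem bex {p : α × ℕ → Prop} (hp : PrimrecPred p) {g : α → ℕ} (hg : Primrec g) :
    PrimrecPred (fun a => ∃ x < g a, p (a, x)) := by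
  have h : PrimrecRel (fun (x : ℕ) (a : α) => p (a, x)) :=
    hp.comp (Primrec.pair Primrec.snd Primrec.fst)
  exact (h.exists_mem_list.comp (Primrec.list_range.comp hg) Primrec.id).of_eq (by simp)

theorem ball {p : α × ℕ → Prop} (hp : PrimrecPred p) {g : α → ℕ} (hg : Primrec g) :
    PrimrecPred (fun a => ∀ x < g a, p (a, x)) := by
  have h : PrimrecRel (fun (x : ℕ) (a : α) => p (a, x)) :=
    hp.comp (Primrec.pair Primrec.snd Primrec.fst)
  exact (h.forall_mem_list.comp (Primrec.list_range.comp hg) Primrec.id).of_eq (by simp)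

theorem imp {p q : α → Prop} (hp : PrimrecPred p) (hq : PrimrecPred q) :
    PrimrecPred (fun a => p a → q a) :=
  (hp.not.or hq).of_eq fun a => by tauto

end

theorem lt_of_testBit {u m : ℕ} (h : Nat.testBit u m = true) : m < u :=
  lt_of_lt_of_le Nat.lt_two_pow_self (Nat.ge_two_pow_of_testBit h)

/-- Inclusion of coded finite sets, in bounded form. -/
theorem sub_iff (u w : ℕ) :
    finCode u ⊆ finCode w ↔ ∀ b < u, Nat.testBit u b = true → Nat.testBit w b = true :=
  ⟨fun h _ _ hb => h hb, fun h b hb => h b (lt_of_testBit hb) hb⟩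

theorem primrec_sub : PrimrecRel (fun u w : ℕ => finCode u ⊆ finCode w) := by
  have h : PrimrecPred (fun p : ℕ × ℕ =>
      ∀ b < p.1, Nat.testBit p.1 b = true → Nat.testBit p.2 b = true) :=
    ball (p := fun x : (ℕ × ℕ) × ℕ => Nat.testBit x.1.1 x.2 = true → Nat.testBit x.1.2 x.2 = true)
      (imp (primrec_testBit.comp (Primrec.fst.comp Primrec.fst) Primrec.snd)
        (primrec_testBit.comp (Primrec.snd.comp Primrec.fst) Primrec.snd)) Primrec.fst
  exact PrimrecPred.of_eq h fun p => (sub_iff p.1 p.2).symm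

theorem finCode_lor (u w : ℕ) : finCode (u ||| w) = finCode u ∪ finCode w := by
  ext n; simp [finCode]

theorem finCode_two_pow (n : ℕ) : finCode (2 ^ n) = {n} := by
  ext m; simp [finCode, Nat.testBit_two_pow, eq_comm]

theorem finCode_zero : finCode 0 = ∅ := by
  ext m; simp [finCode]

/-! ## Positive c.e. predicates -/

section
variable {α : Type} [Primcodable α] {β : Type} [Primcodable β]

/-- `P a B` is uniformly positively c.e. in `B`. -/
def PosRE (P : α → Set ℕ → Prop) : Prop :=
  ∃ q : α × ℕ × ℕ → Prop, PrimrecPred q ∧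
    ∀ a B, P a B ↔ ∃ s u, q (a, s, u) ∧ finCode u ⊆ B

theorem PosRE.of_eq {P Q : α → Set ℕ → Prop} (h : PosRE P) (e : ∀ a B, P a B ↔ Q a B) :
    PosRE Q := by
  have : P = Q := by funext a B; exact propext (e a B)
  exact this ▸ h

theorem PosRE.comp {P : β → Set ℕ → Prop} (h : PosRE P) {g : α → β} (hg : Primrec g) :
    PosRE (fun a B => P (g a) B) := by
  obtain ⟨q, hq, e⟩ := h
  refine ⟨fun x => q (g x.1, x.2), hq.comp ?_, fun a B => e (g a) B⟩
  exact Primrec.pair (hg.comp Primrec.fst) Primrec.snd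

theorem PosRE.or {P Q : α → Set ℕ → Prop} (hP : PosRE P) (hQ : PosRE Q) :
    PosRE (fun a B => P a B ∨ Q a B) := by
  obtain ⟨q, hq, e⟩ := hP
  obtain ⟨r, hr, e'⟩ := hQ
  refine ⟨fun x => q x ∨ r x, hq.or hr, fun a B => ?_⟩
  beta_reduce
  rw [e, e']
  constructor
  · rintro (⟨s, u, h, h'⟩ | ⟨s, u, h, h'⟩)
    exacts [⟨s, u, Or.inl h, h'⟩, ⟨s, u, Or.inr h, h'⟩]
  · rintro ⟨s, u, h | h, h'⟩
    exacts [Or.inl ⟨s, u, h, h'⟩, Or.inr ⟨s, u, h, h'⟩]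

theorem PosRE.ex {P : α × ℕ → Set ℕ → Prop} (hP : PosRE P) :
    PosRE (fun a B => ∃ k, P (a, k) B) := by
  obtain ⟨q, hq, e⟩ := hP
  refine ⟨fun x => q ((x.1, x.2.1.unpair.1), x.2.1.unpair.2, x.2.2), hq.comp ?_, fun a B => ?_⟩
  · have h1 : Primrec (fun x : α × ℕ × ℕ => x.2.1.unpair) :=
      Primrec.unpair.comp (Primrec.fst.comp Primrec.snd)
    exact Primrec.pair (Primrec.pair Primrec.fst (Primrec.fst.comp h1))
      (Primrec.pair (Primrec.snd.comp h1) (Primrec.snd.comp Primrec.snd))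
  · constructor
    · rintro ⟨k, hk⟩
      obtain ⟨s, u, h, h'⟩ := (e _ _).1 hk
      exact ⟨Nat.pair k s, u, by simpa using h, h'⟩
    · rintro ⟨s, u, h, h'⟩
      exact ⟨s.unpair.1, (e _ _).2 ⟨s.unpair.2, u, h, h'⟩⟩

theorem PosRE.mem {g : α → ℕ} (hg : Primrec g) : PosRE (fun a B => g a ∈ B) := by
  refine ⟨fun x => Nat.testBit x.2.2 (g x.1) = true,
    primrec_testBit.comp (Primrec.snd.comp Primrec.snd) (hg.comp Primrec.fst), fun a B => ?_⟩
  constructor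
  · intro h
    refine ⟨0, 2 ^ (g a), by simp, ?_⟩
    rw [finCode_two_pow]; simpa using h
  · rintro ⟨_, u, h, h'⟩
    exact h' h

theorem PosRE.pred {p : α → Prop} (hp : PrimrecPred p) : PosRE (fun a _ => p a) := by
  refine ⟨fun x => p x.1, hp.comp Primrec.fst, fun a B => ?_⟩
  exact ⟨fun h => ⟨0, 0, h, by simp [finCode_zero]⟩, fun ⟨_, _, h, _⟩ => h⟩

/-- Bounded form of a positive c.e. predicate. -/
theorem bounded_primrec {q : α × ℕ × ℕ → Prop} (hq : PrimrecPred q) :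
    PrimrecPred (fun x : α × ℕ × ℕ =>
      ∃ s < x.2.1, ∃ u < x.2.1, q (x.1, s, u) ∧ finCode u ⊆ finCode x.2.2) := by
  refine bex (p := fun y : (α × ℕ × ℕ) × ℕ =>
    ∃ u < y.1.2.1, q (y.1.1, y.2, u) ∧ finCode u ⊆ finCode y.1.2.2) ?_
    (Primrec.fst.comp Primrec.snd)
  refine bex (p := fun z : ((α × ℕ × ℕ) × ℕ) × ℕ =>
    q (z.1.1.1, z.1.2, z.2) ∧ finCode z.2 ⊆ finCode z.1.1.2.2) ?_
    (Primrec.fst.comp (Primrec.snd.comp Primrec.fst))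
  have h0 : Primrec (fun z : ((α × ℕ × ℕ) × ℕ) × ℕ => z.1.1) := Primrec.fst.comp Primrec.fst
  refine PrimrecPred.and (hq.comp ?_) (primrec_sub.comp Primrec.snd ?_)
  · exact Primrec.pair (Primrec.fst.comp h0)
      (Primrec.pair (Primrec.snd.comp Primrec.fst) Primrec.snd)
  · exact Primrec.snd.comp (Primrec.snd.comp h0)

theorem PosRE.and {P Q : α → Set ℕ → Prop} (hP : PosRE P) (hQ : PosRE Q) :
    PosRE (fun a B => P a B ∧ Q a B) := by
  obtain ⟨q, hq, e⟩ := hP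
  obtain ⟨r, hr, e'⟩ := hQ
  refine ⟨_, (bounded_primrec hq).and (bounded_primrec hr), fun a B => ?_⟩
  beta_reduce
  rw [e, e']
  constructor
  · rintro ⟨⟨s, u, h, hB⟩, ⟨s', u', h', hB'⟩⟩
    refine ⟨s + u + s' + u' + 1, u ||| u', ⟨⟨s, by simp <;> omega, u, by simp <;> omega, h, ?_⟩,
      ⟨s', by simp <;> omega, u', by simp <;> omega, h', ?_⟩⟩, ?_⟩
    · simp [finCode_lor]
    · simp [finCode_lor]
    · rw [finCode_lor]; exact Set.union_subset hB hB'
  · rintro ⟨t, w, ⟨⟨s, _, u, _, h, hs⟩, ⟨s', _, u', _, h', hs'⟩⟩, hw⟩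
    exact ⟨⟨s, u, h, hs.trans hw⟩, ⟨s', u', h', hs'.trans hw⟩⟩

/-- Substitution of a uniformly positive c.e. set for the oracle. -/
theorem PosRE.subst {P : α → Set ℕ → Prop} {Q : α × ℕ → Set ℕ → Prop}
    (hP : PosRE P) (hQ : PosRE Q) : PosRE (fun a B => P a {m | Q (a, m) B}) := by
  obtain ⟨q, hq, e⟩ := hP
  obtain ⟨r, hr, e'⟩ := hQ
  let body : (α × ℕ) × ℕ × ℕ → Prop := fun y =>
      ∃ s < y.2.1, ∃ u < y.2.1, r (y.1, s, u) ∧ finCode u ⊆ finCode y.2.2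
  have hbody : PrimrecPred body := bounded_primrec hr
  refine ⟨fun x => ∃ s < x.2.1, ∃ u < x.2.1, q (x.1, s, u) ∧
    ∀ m < u, Nat.testBit u m = true → body ((x.1, m), x.2.1, x.2.2), ?_, fun a B => ?_⟩
  · refine bex (p := fun y : (α × ℕ × ℕ) × ℕ =>
      ∃ u < y.1.2.1, q (y.1.1, y.2, u) ∧
        ∀ m < u, Nat.testBit u m = true → body ((y.1.1, m), y.1.2.1, y.1.2.2)) ?_
      (Primrec.fst.comp Primrec.snd)
    refine bex (p := fun z : ((α × ℕ × ℕ) × ℕ) × ℕ =>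
      q (z.1.1.1, z.1.2, z.2) ∧
        ∀ m < z.2, Nat.testBit z.2 m = true → body ((z.1.1.1, m), z.1.1.2.1, z.1.1.2.2)) ?_
      (Primrec.fst.comp (Primrec.snd.comp Primrec.fst))
    have h0 : Primrec (fun z : ((α × ℕ × ℕ) × ℕ) × ℕ => z.1.1) := Primrec.fst.comp Primrec.fst
    refine PrimrecPred.and (hq.comp ?_) ?_
    · exact Primrec.pair (Primrec.fst.comp h0)
        (Primrec.pair (Primrec.snd.comp Primrec.fst) Primrec.snd)
    · refine ball (p := fun v : (((α × ℕ × ℕ) × ℕ) × ℕ) × ℕ =>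
        Nat.testBit v.1.2 v.2 = true →
          body ((v.1.1.1.1, v.2), v.1.1.1.2.1, v.1.1.1.2.2)) ?_ Primrec.snd
      refine imp (primrec_testBit.comp (Primrec.snd.comp Primrec.fst) Primrec.snd)
        (hbody.comp ?_)
      have h1 : Primrec (fun v : (((α × ℕ × ℕ) × ℕ) × ℕ) × ℕ => v.1.1.1) :=
        h0.comp Primrec.fst
      exact Primrec.pair (Primrec.pair (Primrec.fst.comp h1) Primrec.snd)
        (Primrec.snd.comp h1)
  · beta_reduce
    rw [e]
    constructor
    · rintro ⟨s, u, h, hu⟩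
      have key : ∀ N : ℕ, ∃ t w, finCode w ⊆ B ∧ ∀ m < N, Nat.testBit u m = true →
          ∃ s < t, ∃ v < t, r ((a, m), s, v) ∧ finCode v ⊆ finCode w := by
        intro N
        induction N with
        | zero => exact ⟨0, 0, by simp [finCode_zero], by simp⟩
        | succ N ih =>
          obtain ⟨t, w, hw, H⟩ := ih
          by_cases hN : Nat.testBit u N = true
          · obtain ⟨s', v', h', hv'⟩ := (e' _ _).1 (hu hN)
            refine ⟨t + s' + v' + 1, w ||| v', ?_, ?_⟩
            · rw [finCode_lor]; exact Set.union_subset hw hv'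
            · intro m hm hb
              rcases Nat.lt_succ_iff_lt_or_eq.1 hm with hm | rfl
              · obtain ⟨s1, hs1, v1, hv1, hr1, hsub⟩ := H m hm hb
                refine ⟨s1, by omega, v1, by omega, hr1, hsub.trans ?_⟩
                simp [finCode_lor]
              · refine ⟨s', by omega, v', by omega, h', ?_⟩
                simp [finCode_lor]
          · refine ⟨t, w, hw, fun m hm hb => ?_⟩
            rcases Nat.lt_succ_iff_lt_or_eq.1 hm with hm | rfl
            · exact H m hm hb
            · exact absurd hb hN
      obtain ⟨t, w, hw, H⟩ := key u
      refine ⟨t + s + u + 1, w, ⟨s, by simp <;> omega, u, by simp <;> omega, h, ?_⟩, hw⟩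
      intro m hm hb
      obtain ⟨s1, hs1, v1, hv1, hr1, hsub⟩ := H m hm hb
      exact ⟨s1, by simp <;> omega, v1, by simp <;> omega, hr1, hsub⟩
    · rintro ⟨t, w, ⟨s, _, u, _, h, H⟩, hw⟩
      refine ⟨s, u, h, fun m hm => ?_⟩
      obtain ⟨s1, _, v1, _, hr1, hsub⟩ := H m (lt_of_testBit hm) hm
      exact (e' _ _).2 ⟨s1, v1, hr1, hsub.trans hw⟩

end

/-! ## Enumeration operators -/

theorem posRE_eOp : PosRE (fun (p : ℕ × ℕ) B => p.2 ∈ eOp p.1 B) := by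
  refine ⟨fun x => (Nat.Partrec.Code.evaln x.2.1 (Denumerable.ofNat Nat.Partrec.Code x.1.1)
    (Nat.pair x.1.2 x.2.2)).isSome = true, ?_, ?_⟩
  · have h1 : Primrec (fun x : (ℕ × ℕ) × ℕ × ℕ =>
        Nat.Partrec.Code.evaln x.2.1 (Denumerable.ofNat Nat.Partrec.Code x.1.1)
          (Nat.pair x.1.2 x.2.2)) := by
      refine Nat.Partrec.Code.primrec_evaln.comp
        (Primrec.pair (Primrec.pair (Primrec.fst.comp Primrec.snd) ?_) ?_)
      · exact (Primrec.ofNat Nat.Partrec.Code).comp (Primrec.fst.comp Primrec.fst)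
      · exact Primrec₂.natPair.comp (Primrec.snd.comp Primrec.fst)
          (Primrec.snd.comp Primrec.snd)
    exact PrimrecRel.comp Primrec.eq (Primrec.option_isSome.comp h1) (Primrec.const true)
  · rintro ⟨i, n⟩ B
    have key : ∀ m, m ∈ ceSet i ↔ ∃ s, (Nat.Partrec.Code.evaln s
        (Denumerable.ofNat Nat.Partrec.Code i) m).isSome = true := by
      intro m
      simp only [ceSet, Set.mem_ofPred_eq, Part.dom_iff_mem, Option.isSome_iff_exists]
      constructor
      · rintro ⟨y, hy⟩
        obtain ⟨k, hk⟩ := Nat.Partrec.Code.evaln_complete.1 hy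
        exact ⟨k, y, hk⟩
      · rintro ⟨k, y, hk⟩
        exact ⟨y, Nat.Partrec.Code.evaln_complete.2 ⟨k, hk⟩⟩
    simp only [eOp, Set.mem_ofPred_eq, key]
    constructor
    · rintro ⟨u, ⟨s, h⟩, h'⟩; exact ⟨s, u, h, h'⟩
    · rintro ⟨s, u, h, h'⟩; exact ⟨u, ⟨s, h⟩, h'⟩

/-- The `s-m-n` theorem for enumeration operators. -/
theorem PosRE.smn {P : ℕ × ℕ → Set ℕ → Prop} (h : PosRE P) :
    ∃ g : ℕ → ℕ, Primrec g ∧ ∀ a B, eOp (g a) B = {n | P (a, n) B} := by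
  obtain ⟨q, hq, e⟩ := h
  let F : ℕ → ℕ → Bool := fun m s =>
    decide (q ((m.unpair.1, m.unpair.2.unpair.1), s, m.unpair.2.unpair.2))
  have hF : Primrec₂ F := by
    refine PrimrecPred.decide (hq.comp ?_)
    have h1 : Primrec (fun x : ℕ × ℕ => x.1.unpair) := Primrec.unpair.comp Primrec.fst
    have h2 : Primrec (fun x : ℕ × ℕ => x.1.unpair.2.unpair) :=
      Primrec.unpair.comp (Primrec.snd.comp h1)
    exact Primrec.pair (Primrec.pair (Primrec.fst.comp h1) (Primrec.fst.comp h2))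
      (Primrec.pair Primrec.snd (Primrec.snd.comp h2))
  have hpr : Partrec (fun m : ℕ => Nat.rfind (fun s => (F m s : Part Bool))) :=
    Partrec.rfind hF.to_comp.partrec₂
  obtain ⟨c, hc⟩ := Nat.Partrec.Code.exists_code.1 (Partrec.nat_iff.1 hpr)
  refine ⟨fun a => Encodable.encode (Nat.Partrec.Code.curry c a), ?_, fun a B => ?_⟩
  · exact Primrec.encode.comp
      (Nat.Partrec.Code.primrec₂_curry.comp (Primrec.const c) Primrec.id)
  · ext n
    simp only [eOp, ceSet, Set.mem_ofPred_eq, Denumerable.ofNat_encode,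
      Nat.Partrec.Code.eval_curry, hc, e]
    have key : ∀ u, (Nat.rfind (fun s =>
        (F (Nat.pair a (Nat.pair n u)) s : Part Bool))).Dom ↔ ∃ s, q ((a, n), s, u) := by
      intro u
      refine Nat.rfind_dom'.trans ?_
      simp [F]
    simp only [key]
    constructor
    · rintro ⟨u, ⟨s, h⟩, h'⟩; exact ⟨s, u, h, h'⟩
    · rintro ⟨s, u, h, h'⟩; exact ⟨u, ⟨s, h⟩, h'⟩

/-- `Φ` is (given by) an enumeration operator. -/
def IsEOp (Φ : Set ℕ → Set ℕ) : Prop := PosRE (fun n B => n ∈ Φ B)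

theorem isEOp_eOp (i : ℕ) : IsEOp (eOp i) :=
  posRE_eOp.comp (g := fun n : ℕ => (i, n)) (Primrec.pair (Primrec.const i) Primrec.id)

theorem IsEOp.index {Φ : Set ℕ → Set ℕ} (h : IsEOp Φ) : ∃ i, ∀ B, Φ B = eOp i B := by
  obtain ⟨g, _, hg⟩ := PosRE.smn (PosRE.comp h (Primrec.snd (α := ℕ) (β := ℕ)))
  exact ⟨g 0, fun B => by rw [hg]; rfl⟩

section
variable {α : Type} [Primcodable α]

/-- Membership in an enumeration operator applied to a uniformly enumerable set. -/
theorem IsEOp.memApp {Φ : Set ℕ → Set ℕ} (h : IsEOp Φ) {Q : α × ℕ → Set ℕ → Prop}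
    (hQ : PosRE Q) {g : α → ℕ} (hg : Primrec g) :
    PosRE (fun a B => g a ∈ Φ {m | Q (a, m) B}) :=
  PosRE.subst (PosRE.comp h hg) hQ

theorem IsEOp.memComp {Φ Ψ : Set ℕ → Set ℕ} (h : IsEOp Φ) (h' : IsEOp Ψ)
    {g : α → ℕ} (hg : Primrec g) : PosRE (fun a B => g a ∈ Φ (Ψ B)) :=
  h.memApp (PosRE.comp h' (Primrec.snd (α := α) (β := ℕ))) hg

end

theorem isEOp_id : IsEOp (fun B => B) := PosRE.mem Primrec.id

theorem IsEOp.comp {Φ Ψ : Set ℕ → Set ℕ} (h : IsEOp Φ) (h' : IsEOp Ψ) :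
    IsEOp (fun B => Φ (Ψ B)) := h.memComp h' Primrec.id

theorem isEOp_iter {Φ : Set ℕ → Set ℕ} (h : IsEOp Φ) :
    PosRE (fun (p : ℕ × ℕ) B => p.2 ∈ Φ^[p.1] B) := by
  have h1 : PosRE (fun (p : ℕ × ℕ) B => p.2 ∈ Φ (eOp p.1 B)) := by
    refine h.memApp (Q := fun (x : (ℕ × ℕ) × ℕ) B => x.2 ∈ eOp x.1.1 B) ?_ Primrec.snd
    exact posRE_eOp.comp (g := fun x : (ℕ × ℕ) × ℕ => (x.1.1, x.2))
      (Primrec.pair (Primrec.fst.comp Primrec.fst) Primrec.snd)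
  obtain ⟨g, hg, hgeq⟩ := h1.smn
  obtain ⟨e, he⟩ := isEOp_id.index
  have hit : ∀ k B, Φ^[k] B = eOp (g^[k] e) B := by
    intro k B
    induction k with
    | zero => exact he B
    | succ k ih =>
      rw [Function.iterate_succ_apply', Function.iterate_succ_apply', ih, hgeq]; rfl
  have hpr : Primrec (fun p : ℕ × ℕ => (g^[p.1] e, p.2)) :=
    Primrec.pair
      (Primrec.nat_iterate Primrec.fst (Primrec.const e) (hg.comp Primrec.snd).to₂)
      Primrec.snd
  exact (posRE_eOp.comp hpr).of_eq fun p B => by rw [hit]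

theorem ELe.of_isEOp {Φ : Set ℕ → Set ℕ} (h : IsEOp Φ) (B : Set ℕ) : ELe (Φ B) B := by
  obtain ⟨i, hi⟩ := h.index
  exact ⟨i, hi B⟩

theorem ele_iff {A B : Set ℕ} : ELe A B ↔ ∃ Φ, IsEOp Φ ∧ A = Φ B :=
  ⟨fun ⟨i, hi⟩ => ⟨eOp i, isEOp_eOp i, hi⟩, fun ⟨_, h, e⟩ => e ▸ ELe.of_isEOp h B⟩

/-! ## The join -/

def J (X Y : Set ℕ) : Set ℕ :=
  {m | (m.unpair.1 = 0 ∧ m.unpair.2 ∈ X) ∨ (m.unpair.1 = 1 ∧ m.unpair.2 ∈ Y)}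

def lft (C : Set ℕ) : Set ℕ := {x | Nat.pair 0 x ∈ C}

def rgt (C : Set ℕ) : Set ℕ := {x | Nat.pair 1 x ∈ C}

@[simp] theorem lft_J (X Y : Set ℕ) : lft (J X Y) = X := by ext x; simp [lft, J]

@[simp] theorem rgt_J (X Y : Set ℕ) : rgt (J X Y) = Y := by ext x; simp [rgt, J]

theorem J_mono {X Y X' Y' : Set ℕ} (h : X ⊆ X') (h' : Y ⊆ Y') : J X Y ⊆ J X' Y' := by
  rintro m (⟨h1, h2⟩ | ⟨h1, h2⟩)
  exacts [Or.inl ⟨h1, h h2⟩, Or.inr ⟨h1, h' h2⟩]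

theorem isEOp_lft : IsEOp lft :=
  PosRE.mem (Primrec₂.natPair.comp (Primrec.const 0) Primrec.id)

theorem isEOp_rgt : IsEOp rgt :=
  PosRE.mem (Primrec₂.natPair.comp (Primrec.const 1) Primrec.id)

theorem IsEOp.J {Φ Ψ : Set ℕ → Set ℕ} (h : IsEOp Φ) (h' : IsEOp Ψ) :
    IsEOp (fun B => J (Φ B) (Ψ B)) := by
  have h1 : Primrec (fun m : ℕ => m.unpair.1) := Primrec.fst.comp Primrec.unpair
  have h2 : Primrec (fun m : ℕ => m.unpair.2) := Primrec.snd.comp Primrec.unpair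
  exact PosRE.or
    (PosRE.and (PosRE.pred (PrimrecRel.comp Primrec.eq h1 (Primrec.const 0))) (PosRE.comp h h2))
    (PosRE.and (PosRE.pred (PrimrecRel.comp Primrec.eq h1 (Primrec.const 1))) (PosRE.comp h' h2))

theorem isEOp_empty : IsEOp (fun _ => ∅) := by
  refine PosRE.of_eq (PosRE.pred (p := fun _ : ℕ => (0 : ℕ) = 1) ?_) (by simp)
  exact PrimrecRel.comp Primrec.eq (Primrec.const 0) (Primrec.const 1)

theorem isEOp_singleton (k : ℕ) : IsEOp (fun _ => {k}) :=
  PosRE.of_eq (PosRE.pred (p := fun n : ℕ => n = k)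
    (PrimrecRel.comp Primrec.eq Primrec.id (Primrec.const k))) (by simp)

/-- shift a set up by one -/
def up (C : Set ℕ) : Set ℕ := {x | x ≠ 0 ∧ x - 1 ∈ C}

def down (C : Set ℕ) : Set ℕ := {x | x + 1 ∈ C}

theorem isEOp_up : IsEOp up :=
  PosRE.and (PosRE.pred (PrimrecPred.not
    (PrimrecRel.comp Primrec.eq Primrec.id (Primrec.const 0)))) (PosRE.mem Primrec.pred)

theorem isEOp_down : IsEOp down := PosRE.mem Primrec.succ

theorem up_singleton (k : ℕ) : up {k} = {k + 1} := by
  ext x; simp only [up, Set.mem_ofPred_eq, Set.mem_singleton_iff]; omega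

theorem down_singleton (k : ℕ) : down {k + 1} = {k} := by
  ext x; simp [down]

theorem isEOp_KSet : IsEOp KSet := posRE_eOp.comp Primrec.unpair

/-! ## Degrees and uniform invariance -/

theorem mem_edeg_iff {A B : Set ℕ} :
    B ∈ edeg A ↔ ∃ Φ Ψ, IsEOp Φ ∧ IsEOp Ψ ∧ B = Φ A ∧ A = Ψ B := by
  constructor
  · rintro ⟨h1, h2⟩
    obtain ⟨Ψ, hΨ, e1⟩ := ele_iff.1 h1
    obtain ⟨Φ, hΦ, e2⟩ := ele_iff.1 h2
    exact ⟨Φ, Ψ, hΦ, hΨ, e2, e1⟩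
  · rintro ⟨Φ, Ψ, hΦ, hΨ, e1, e2⟩
    exact ⟨ele_iff.2 ⟨Ψ, hΨ, e2⟩, ele_iff.2 ⟨Φ, hΦ, e1⟩⟩

theorem self_mem (A : Set ℕ) : A ∈ edeg A :=
  mem_edeg_iff.2 ⟨_, _, isEOp_id, isEOp_id, rfl, rfl⟩

theorem mem_edeg_trans {A B C : Set ℕ} (hB : B ∈ edeg A) {Φ Ψ : Set ℕ → Set ℕ}
    (hΦ : IsEOp Φ) (hΨ : IsEOp Ψ) (e1 : C = Φ B) (e2 : B = Ψ C) : C ∈ edeg A := by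
  obtain ⟨Φ', Ψ', h1, h2, e1', e2'⟩ := mem_edeg_iff.1 hB
  refine mem_edeg_iff.2 ⟨_, _, hΦ.comp h1, h2.comp hΨ, ?_, ?_⟩
  · rw [← e1', e1]
  · rw [← e2, e2']

theorem J_mem {A S : Set ℕ} (h : S ∈ edeg A) (k : ℕ) : J S {k} ∈ edeg A :=
  mem_edeg_trans h (isEOp_id.J (isEOp_singleton k)) isEOp_lft rfl (by simp)

/-- Uniform invariance, with indices hidden. -/
theorem uniform {D : Set (Set ℕ)} {f : Set ℕ → Set ℕ} (hf : UniformlyEInvariantOn D f)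
    {Φ Ψ : Set ℕ → Set ℕ} (hΦ : IsEOp Φ) (hΨ : IsEOp Ψ) :
    ∃ Θ, IsEOp Θ ∧ ∀ S ∈ D, ∀ T ∈ D, T = Φ S → S = Ψ T → f T = Θ (f S) := by
  obtain ⟨u, hu⟩ := hf
  obtain ⟨i, hi⟩ := hΦ.index
  obtain ⟨j, hj⟩ := hΨ.index
  refine ⟨eOp (u (Nat.pair i j)).unpair.1, isEOp_eOp _, fun S hS T hT e1 e2 => ?_⟩
  exact (hu T hT S hS i j ⟨e1.trans (hi S), e2.trans (hj T)⟩).1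

/-- For a nested, uniformly recoverable pair `Y ⊆ X`, the family switching from `Y` to `X`
when `k` enters `ΦT A` is handled uniformly by `f`. -/
theorem switch {A : Set ℕ} {f : Set ℕ → Set ℕ} (hf : UniformlyEInvariantOn (edeg A) f)
    {X Y : Set ℕ} {Γ ΦX ΦY ΦT : Set ℕ → Set ℕ} (hΓ : IsEOp Γ) (hX : IsEOp ΦX) (hY : IsEOp ΦY)
    (hT : IsEOp ΦT) (hYX : Y ⊆ X) (eX : X = ΦX A) (eY : Y = ΦY A)
    (gX : A = Γ X) (gY : A = Γ Y) (n : ℕ) :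
    ELe {k | n ∈ f (if k ∈ ΦT A then X else Y)} (f A) := by
  set Z : ℕ → Set ℕ := fun k => if k ∈ ΦT A then X else Y with hZ
  have gZ : ∀ k, A = Γ (Z k) := by
    intro k; by_cases hk : k ∈ ΦT A <;> simp only [hZ, hk, if_true, if_false] <;> assumption
  have mX : X ∈ edeg A := mem_edeg_iff.2 ⟨_, _, hX, hΓ, eX, gX⟩
  have mY : Y ∈ edeg A := mem_edeg_iff.2 ⟨_, _, hY, hΓ, eY, gY⟩
  have mZ : ∀ k, Z k ∈ edeg A := by
    intro k; by_cases hk : k ∈ ΦT A <;> simp only [hZ, hk, if_true, if_false] <;> assumption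
  have upOp : IsEOp (fun B => J (lft B) (up (rgt B))) := isEOp_lft.J (isEOp_up.comp isEOp_rgt)
  have downOp : IsEOp (fun B => J (lft B) (down (rgt B))) :=
    isEOp_lft.J (isEOp_down.comp isEOp_rgt)
  -- start
  obtain ⟨Θa, ha, Ha⟩ := uniform hf (isEOp_id.J (isEOp_singleton 0)) isEOp_lft
  -- finish
  obtain ⟨Θe, he, He⟩ := uniform hf isEOp_lft (isEOp_id.J (isEOp_singleton 0))
  obtain ⟨Θb, hb, Hb⟩ := uniform hf upOp downOp
  obtain ⟨Θd, hd, Hd⟩ := uniform hf downOp upOp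
  let M : Set ℕ → Set ℕ := fun C =>
    {x | x ∈ ΦY (lft C) ∨ (x ∈ ΦX (lft C) ∧ ∃ k, k ∈ rgt C ∧ k ∈ ΦT (lft C))}
  have hM : IsEOp M := by
    refine PosRE.or (hY.comp isEOp_lft) (PosRE.and (hX.comp isEOp_lft) ?_)
    exact PosRE.ex (P := fun (p : ℕ × ℕ) C => p.2 ∈ rgt C ∧ p.2 ∈ ΦT (lft C))
      (PosRE.and (PosRE.comp isEOp_rgt Primrec.snd) (hT.memComp isEOp_lft Primrec.snd))
  obtain ⟨Θc, hc, Hc⟩ := uniform hf (hM.J isEOp_rgt) ((hΓ.comp isEOp_lft).J isEOp_rgt)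
  have eM : ∀ k, M (J A {k}) = Z k := by
    intro k
    ext x
    simp only [M, lft_J, rgt_J, Set.mem_ofPred_eq, Set.mem_singleton_iff, exists_eq_left,
      ← eX, ← eY, hZ]
    by_cases hk : k ∈ ΦT A
    · simp only [hk, if_true, and_true]
      exact ⟨fun h => h.elim (fun h => hYX h) id, Or.inr⟩
    · simp [hk]
  have s1 : f (J A {0}) = Θa (f A) := Ha _ (self_mem A) _ (J_mem (self_mem A) 0) rfl (by simp)
  have s2 : ∀ k, f (J A {k}) = Θb^[k] (f (J A {0})) := by
    intro k
    induction k with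
    | zero => rfl
    | succ k ih =>
      rw [Function.iterate_succ_apply', ← ih]
      exact Hb _ (J_mem (self_mem A) k) _ (J_mem (self_mem A) _)
        (by simp [up_singleton]) (by simp [down_singleton])
  have s3 : ∀ k, f (J (Z k) {k}) = Θc (f (J A {k})) := by
    intro k
    exact Hc _ (J_mem (self_mem A) k) _ (J_mem (mZ k) k) (by simp [eM]) (by simp [← gZ])
  have s4 : ∀ S ∈ edeg A, ∀ k, f (J S {0}) = Θd^[k] (f (J S {k})) := by
    intro S hS k
    induction k with
    | zero => rfl
    | succ k ih =>
      rw [Function.iterate_succ_apply, ih]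
      congr 1
      exact Hd _ (J_mem hS _) _ (J_mem hS _)
        (by simp [down_singleton]) (by simp [up_singleton])
  have s5 : ∀ S ∈ edeg A, f S = Θe (f (J S {0})) := by
    intro S hS
    exact He _ (J_mem hS _) _ hS (by simp) rfl
  have tot : ∀ k, f (Z k) = Θe (Θd^[k] (Θc (Θb^[k] (Θa (f A))))) := by
    intro k
    rw [s5 _ (mZ k), s4 _ (mZ k) k, s3, s2, s1]
  -- assemble the operator
  have o1 : PosRE (fun (p : ℕ × ℕ) B => p.2 ∈ Θb^[p.1] (Θa B)) :=
    PosRE.subst (isEOp_iter hb) (PosRE.comp ha (Primrec.snd (α := ℕ × ℕ) (β := ℕ)))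
  have sh : Primrec (fun x : (ℕ × ℕ) × ℕ => (x.1.1, x.2)) :=
    Primrec.pair (Primrec.fst.comp Primrec.fst) Primrec.snd
  have o2 : PosRE (fun (p : ℕ × ℕ) B => p.2 ∈ Θc (Θb^[p.1] (Θa B))) :=
    hc.memApp (o1.comp sh) Primrec.snd
  have o3 : PosRE (fun (p : ℕ × ℕ) B => p.2 ∈ Θd^[p.1] (Θc (Θb^[p.1] (Θa B)))) :=
    PosRE.subst (isEOp_iter hd) (o2.comp sh)
  have o4 : PosRE (fun (k : ℕ) B => n ∈ Θe (Θd^[k] (Θc (Θb^[k] (Θa B))))) :=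
    he.memApp o3 (Primrec.const n)
  refine ele_iff.2 ⟨fun B => {k | n ∈ Θe (Θd^[k] (Θc (Θb^[k] (Θa B))))}, o4, ?_⟩
  ext k
  change n ∈ f (Z k) ↔ _
  rw [tot]; rfl

theorem nested {A : Set ℕ} {f : Set ℕ → Set ℕ} (hf : UniformlyEInvariantOn (edeg A) f)
    {X Y : Set ℕ} {Γ : Set ℕ → Set ℕ} (hΓ : IsEOp Γ) (hYX : Y ⊆ X)
    (mX : X ∈ edeg A) (mY : Y ∈ edeg A)
    (gX : A = Γ X) (gY : A = Γ Y) (hne : f Y ≠ f X) :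
    ELe A (f A) ∨ ELe (eSkip A) (f A) := by
  obtain ⟨ΦX, _, hX, _, eX, _⟩ := mem_edeg_iff.1 mX
  obtain ⟨ΦY, _, hY, _, eY, _⟩ := mem_edeg_iff.1 mY
  have : ∃ n, ¬ (n ∈ f Y ↔ n ∈ f X) := by
    by_contra h
    push Not at h
    exact hne (Set.ext h)
  obtain ⟨n, hn⟩ := this
  by_cases hnX : n ∈ f X
  · have hnY : n ∉ f Y := fun h => hn ⟨fun _ => hnX, fun _ => h⟩
    left
    have h := switch hf hΓ hX hY isEOp_id hYX eX eY gX gY n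
    convert h using 1
    ext k
    by_cases hk : k ∈ A <;> simp [hk, hnX, hnY]
  · have hnY : n ∈ f Y := by tauto
    right
    have h := switch hf hΓ hX hY isEOp_KSet hYX eX eY gX gY n
    convert h using 1
    ext k
    by_cases hk : k ∈ KSet A <;> simp [eSkip, hk, hnX, hnY]

end LocUMC

open LocUMC

/-- **Martin's Conjecture in the enumeration degrees, local version (Theorem
`thm:locumc`).** If `f` is uniformly e-invariant on `deg_e(A)` and not constant
there, then `A ≤ₑ f(A)` or `A^⋄ ≤ₑ f(A)`. -/
theorem locumc (A : Set ℕ) (f : Set ℕ → Set ℕ)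
    (hf : UniformlyEInvariantOn (edeg A) f)
    (hnc : ¬ ∀ X ∈ edeg A, ∀ Y ∈ edeg A, f X = f Y) :
    ELe A (f A) ∨ ELe (eSkip A) (f A) := by
  by_contra hcon
  have link : ∀ {X Y : Set ℕ} {Γ : Set ℕ → Set ℕ}, IsEOp Γ → Y ⊆ X → X ∈ edeg A → Y ∈ edeg A →
      A = Γ X → A = Γ Y → f Y = f X := by
    intro X Y Γ hΓ hYX mX mY gX gY
    by_contra hne
    exact hcon (nested hf hΓ hYX mX mY gX gY hne)
  have mem1 : ∀ X ∈ edeg A, J X ∅ ∈ edeg A := fun X hX =>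
    mem_edeg_trans hX (isEOp_id.J isEOp_empty) isEOp_lft rfl (by simp)
  have mem2 : ∀ X ∈ edeg A, J ∅ X ∈ edeg A := fun X hX =>
    mem_edeg_trans hX (isEOp_empty.J isEOp_id) isEOp_rgt rfl (by simp)
  have mem3 : ∀ X ∈ edeg A, ∀ Y ∈ edeg A, J X Y ∈ edeg A := by
    intro X hX Y hY
    obtain ⟨ΦX, ΨX, hΦX, hΨX, eX, gX⟩ := mem_edeg_iff.1 hX
    obtain ⟨ΦY, ΨY, hΦY, hΨY, eY, gY⟩ := mem_edeg_iff.1 hY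
    exact mem_edeg_iff.2 ⟨_, _, hΦX.J hΦY, hΨX.comp isEOp_lft, by rw [← eX, ← eY],
      by simp [← gX]⟩
  have l1 : ∀ X ∈ edeg A, ∀ Y ∈ edeg A, f (J X ∅) = f (J X Y) := by
    intro X hX Y hY
    obtain ⟨_, Ψ, _, hΨ, _, g⟩ := mem_edeg_iff.1 hX
    exact link (hΨ.comp isEOp_lft) (J_mono subset_rfl (Set.empty_subset _)) (mem3 X hX Y hY)
      (mem1 X hX) (by simp [← g]) (by simp [← g])
  have l2 : ∀ X ∈ edeg A, ∀ Y ∈ edeg A, f (J ∅ Y) = f (J X Y) := by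
    intro X hX Y hY
    obtain ⟨_, Ψ, _, hΨ, _, g⟩ := mem_edeg_iff.1 hY
    exact link (hΨ.comp isEOp_rgt) (J_mono (Set.empty_subset _) subset_rfl) (mem3 X hX Y hY)
      (mem2 Y hY) (by simp [← g]) (by simp [← g])
  obtain ⟨Θ, _, HΘ⟩ := uniform hf isEOp_lft (isEOp_id.J isEOp_empty)
  have back : ∀ X ∈ edeg A, f X = Θ (f (J X ∅)) := fun X hX =>
    HΘ _ (mem1 X hX) _ hX (by simp) rfl
  refine hnc fun X hX Y hY => ?_
  rw [back X hX, back Y hY, l1 X hX Y hY, ← l2 X hX Y hY, l2 Y hY Y hY, ← l1 Y hY Y hY]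
end

section
/- For every Borel function F : P(ℕ) → P(ℕ) there is a Borel uniformly e-invariant function f : P(ℕ) → P(ℕ) such that for every A ⊆ ℕ the set {deg_e(X) : f(X) = F(A)} is a cofinal set of enumeration degrees (i.e., for every Y ⊆ ℕ there is X with Y ≤_e X and f(X) = F(A)). -/
open Classical

theorem primrec_bex {β : Type} [Primcodable β] {R : ℕ → β → Prop} {g : β → ℕ}
    (hR : PrimrecRel R) (hg : Primrec g) : PrimrecPred fun y => ∃ x < g y, R x y :=
  PrimrecPred.of_eq (PrimrecRel.comp (R := fun (L : List ℕ) y => ∃ x ∈ L, R x y) hR.exists_mem_list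
    (Primrec.list_range.comp hg) Primrec.id) (by simp)

theorem primrec_ball {β : Type} [Primcodable β] {R : ℕ → β → Prop} {g : β → ℕ}
    (hR : PrimrecRel R) (hg : Primrec g) : PrimrecPred fun y => ∀ x < g y, R x y :=
  PrimrecPred.of_eq (PrimrecRel.comp (R := fun (L : List ℕ) y => ∀ x ∈ L, R x y) hR.forall_mem_list
    (Primrec.list_range.comp hg) Primrec.id) (by simp)

open Nat.Partrec in
theorem exists_eOp_of_primrec (Q : ℕ → ℕ → ℕ → Prop)
    (hQ : PrimrecPred fun t : (ℕ × ℕ) × ℕ => Q t.1.1 t.1.2 t.2) :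
    ∃ i, ∀ B : Set ℕ, eOp i B = {n | ∃ u, (∃ k, Q n u k) ∧ finCode u ⊆ B} := by
  obtain ⟨hd, hp⟩ := hQ
  let f : ℕ →. ℕ := fun a => Nat.rfind fun k => Part.some (decide (Q a.unpair.1 a.unpair.2 k))
  have hf : Partrec f := by
    apply Partrec.rfind
    have : Primrec fun t : ℕ × ℕ => decide (Q t.1.unpair.1 t.1.unpair.2 t.2) := by
      have := hp.comp (Primrec.pair (Primrec.unpair.comp Primrec.fst) Primrec.snd : Primrec fun t : ℕ × ℕ => (t.1.unpair, t.2))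
      refine this.of_eq fun t => ?_
      simp
    exact this.to_comp.partrec
  obtain ⟨c, hc⟩ := Code.exists_code.1 (Partrec.nat_iff.1 hf)
  refine ⟨Encodable.encode c, fun B => ?_⟩
  ext n
  simp only [eOp, ceSet, Set.mem_ofPred_eq, Denumerable.ofNat_encode, hc]
  refine exists_congr fun u => and_congr_left fun _ => ?_
  simp only [f, Nat.unpair_pair]
  refine Nat.rfind_dom.trans ?_
  simp

theorem primrec_pow2 : Primrec fun n : ℕ => 2 ^ n := by
  have : Primrec fun n : ℕ => Nat.rec (motive := fun _ => ℕ) 1 (fun _ y => 2 * y) n := by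
    apply Primrec.nat_rec₁
    exact (Primrec.nat_mul.comp (Primrec.const 2) Primrec.snd)
  refine this.of_eq fun n => ?_
  induction n with
  | zero => rfl
  | succ n ih => show 2 * _ = _; rw [ih, pow_succ, mul_comm]

theorem primrec_testBit : PrimrecRel fun u n : ℕ => Nat.testBit u n = true := by
  have : PrimrecRel fun u n : ℕ => u / 2 ^ n % 2 = 1 := by
    refine PrimrecRel.comp₂ (Primrec.eq) ?_ (Primrec.const 1)
    exact Primrec.nat_mod.comp (Primrec.nat_div.comp Primrec.fst (primrec_pow2.comp Primrec.snd))
      (Primrec.const 2)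
  refine PrimrecPred.of_eq this fun a => ?_
  simp [Nat.testBit_eq_decide_div_mod_eq]

theorem testBit_lt {u n : ℕ} (h : Nat.testBit u n = true) : n < u :=
  lt_of_lt_of_le (Nat.lt_two_pow_self) (Nat.ge_two_pow_of_testBit h)

theorem exists_finCode {S : Set ℕ} (hS : S.Finite) : ∃ w, finCode w = S := by
  induction S, hS using Set.Finite.induction_on with
  | empty => exact ⟨0, by ext; simp [finCode]⟩
  | @insert a S _ _ ih =>
    obtain ⟨w, rfl⟩ := ih
    refine ⟨w ||| 2 ^ a, ?_⟩
    ext m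
    simp only [finCode, Set.mem_ofPred_eq, Nat.testBit_or, Nat.testBit_two_pow, Set.mem_insert_iff]
    simp only [Bool.or_eq_true, decide_eq_true_eq]
    tauto

theorem finCode_two_pow (n : ℕ) : finCode (2 ^ n) = {n} := by
  ext m; simp [finCode, Nat.testBit_two_pow, eq_comm]

theorem finCode_zero : finCode 0 = ∅ := by ext; simp [finCode]

theorem finCode_finite (u : ℕ) : (finCode u).Finite :=
  (Set.finite_lt_nat u).subset fun _ h => testBit_lt h

theorem exists_eOp_of_map (P : ℕ → Prop) (h : ℕ → ℕ) (hP : PrimrecPred P) (hh : Primrec h) :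
    ∃ i, ∀ B : Set ℕ, eOp i B = {n | P n ∧ finCode (h n) ⊆ B} := by
  obtain ⟨i, hi⟩ := exists_eOp_of_primrec (fun n u _ => P n ∧ u = h n) (by
    refine PrimrecPred.and (hP.comp (Primrec.fst.comp Primrec.fst)) ?_
    exact Primrec.eq.comp (Primrec.snd.comp Primrec.fst) (hh.comp (Primrec.fst.comp Primrec.fst)))
  refine ⟨i, fun B => ?_⟩
  rw [hi]; ext n; simp

theorem exists_eOp_id : ∃ i, ∀ B : Set ℕ, eOp i B = B := by
  obtain ⟨i, hi⟩ := exists_eOp_of_map (fun _ => True) (fun n => 2 ^ n)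
    (PrimrecPred.of_eq (Primrec.eq.comp (Primrec.const 0) (Primrec.const 0) : PrimrecPred fun _ : ℕ => (0:ℕ) = 0) (by simp)) primrec_pow2
  exact ⟨i, fun B => by rw [hi]; ext; simp [finCode_two_pow]⟩

theorem ELe.refl (A : Set ℕ) : ELe A A := by
  obtain ⟨i, hi⟩ := exists_eOp_id
  exact ⟨i, (hi A).symm⟩

theorem ELe.of_map {A B : Set ℕ} (h : ℕ → ℕ) (hh : Primrec h) (H : ∀ n, n ∈ A ↔ h n ∈ B) :
    ELe A B := by
  obtain ⟨i, hi⟩ := exists_eOp_of_map (fun _ => True) (fun n => 2 ^ h n)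
    (PrimrecPred.of_eq (Primrec.eq.comp (Primrec.const 0) (Primrec.const 0) : PrimrecPred fun _ : ℕ => (0:ℕ) = 0) (by simp)) (primrec_pow2.comp hh)
  exact ⟨i, by unfold ELeVia; rw [hi]; ext; simp [finCode_two_pow, H]⟩

open Nat.Partrec in
theorem mem_ceSet_iff (e n : ℕ) :
    n ∈ ceSet e ↔ ∃ k, (Code.evaln k (Denumerable.ofNat Code e) n).isSome = true := by
  simp only [ceSet, Set.mem_ofPred_eq, Part.dom_iff_mem, Code.evaln_complete, Option.isSome_iff_exists]
  exact exists_comm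

open Nat.Partrec in
theorem evaln_isSome_mono {c : Code} {n k l : ℕ} (hkl : k ≤ l)
    (h : (Code.evaln k c n).isSome = true) : (Code.evaln l c n).isSome = true := by
  rw [Option.isSome_iff_exists] at *
  obtain ⟨x, hx⟩ := h
  exact ⟨x, Code.evaln_mono hkl hx⟩

open Nat.Partrec in
theorem ELe.trans {A B C : Set ℕ} (hAB : ELe A B) (hBC : ELe B C) : ELe A C := by
  obtain ⟨i, rfl⟩ := hAB
  obtain ⟨j, rfl⟩ := hBC
  let E : ℕ → ℕ → ℕ → Prop := fun c k a => (Code.evaln k (Denumerable.ofNat Code c) a).isSome = true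
  have hE : ∀ c, PrimrecRel (E c) := fun c => by
    have h1 : Primrec fun t : ℕ × ℕ => (Code.evaln t.1 (Denumerable.ofNat Code c) t.2).isSome :=
      Primrec.option_isSome.comp (Code.primrec_evaln.comp
        (Primrec.pair (Primrec.pair Primrec.fst (Primrec.const _)) Primrec.snd))
    exact PrimrecPred.of_eq (Primrec.eq.comp h1 (Primrec.const true)) fun t => Iff.rfl
  let sub : ℕ → ℕ → Prop := fun v w => ∀ x < v, Nat.testBit v x = true → Nat.testBit w x = true
  have hsubiff : ∀ v w, sub v w ↔ finCode v ⊆ finCode w := fun v w =>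
    ⟨fun h x hx => h x (testBit_lt hx) hx, fun h x _ hx => h hx⟩
  have hsub : PrimrecRel sub := by
    have h1 : PrimrecRel fun (x : ℕ) (y : ℕ × ℕ) =>
        ¬ (Nat.testBit y.1 x = true) ∨ Nat.testBit y.2 x = true :=
      PrimrecPred.or (PrimrecPred.not (primrec_testBit.comp (Primrec.fst.comp Primrec.snd) Primrec.fst))
        (primrec_testBit.comp (Primrec.snd.comp Primrec.snd) Primrec.fst)
    refine PrimrecPred.of_eq (primrec_ball h1 Primrec.fst) fun y => ?_
    simp only [sub, imp_iff_not_or]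
  -- inner existential
  let I : ℕ → ℕ × ℕ → Prop := fun m y => ∃ v < y.1, E j y.1 (Nat.pair m v) ∧ sub v y.2
  have hI : PrimrecRel I := by
    have h1 : PrimrecRel fun (v : ℕ) (y : ℕ × ℕ × ℕ) => E j y.2.1 (Nat.pair y.1 v) ∧ sub v y.2.2 :=
      PrimrecPred.and
        ((hE j).comp (Primrec.fst.comp (Primrec.snd.comp Primrec.snd))
          (Primrec₂.natPair.comp (Primrec.fst.comp Primrec.snd) Primrec.fst))
        (hsub.comp Primrec.fst (Primrec.snd.comp (Primrec.snd.comp Primrec.snd)))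
    exact PrimrecPred.of_eq (primrec_bex h1 (Primrec.fst.comp Primrec.snd)) fun y => Iff.rfl
  let M : ℕ → ℕ × ℕ → Prop := fun u y => ∀ m < u, Nat.testBit u m = true → I m y
  have hM : PrimrecRel M := by
    have h1 : PrimrecRel fun (m : ℕ) (y : ℕ × ℕ × ℕ) => ¬ (Nat.testBit y.1 m = true) ∨ I m y.2 :=
      PrimrecPred.or (PrimrecPred.not (primrec_testBit.comp (Primrec.fst.comp Primrec.snd) Primrec.fst))
        (hI.comp Primrec.fst (Primrec.snd.comp Primrec.snd))
    refine PrimrecPred.of_eq (primrec_ball h1 Primrec.fst) fun y => ?_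
    simp only [M, imp_iff_not_or]
  let Q : ℕ → ℕ → ℕ → Prop := fun n w k => ∃ u < k, E i k (Nat.pair n u) ∧ M u (k, w)
  have hQ : PrimrecPred fun t : (ℕ × ℕ) × ℕ => Q t.1.1 t.1.2 t.2 := by
    have h1 : PrimrecRel fun (u : ℕ) (y : (ℕ × ℕ) × ℕ) => E i y.2 (Nat.pair y.1.1 u) ∧ M u (y.2, y.1.2) :=
      PrimrecPred.and
        ((hE i).comp (Primrec.snd.comp Primrec.snd)
          (Primrec₂.natPair.comp (Primrec.fst.comp (Primrec.fst.comp Primrec.snd)) Primrec.fst))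
        (hM.comp Primrec.fst (Primrec.pair (Primrec.snd.comp Primrec.snd)
          (Primrec.snd.comp (Primrec.fst.comp Primrec.snd))))
    exact PrimrecPred.of_eq (primrec_bex h1 Primrec.snd) fun y => Iff.rfl
  obtain ⟨l, hl⟩ := exists_eOp_of_primrec Q hQ
  refine ⟨l, ?_⟩
  unfold ELeVia
  rw [hl]
  ext n
  constructor
  · rintro ⟨u, hu, hsubB⟩
    have hsB : ∀ m, m ∈ finCode u → ∃ v, Nat.pair m v ∈ ceSet j ∧ finCode v ⊆ C :=
      fun m hm => hsubB hm
    choose! v hv' using hsB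
    have hv : ∀ {m}, m ∈ finCode u → Nat.pair m (v m) ∈ ceSet j ∧ finCode (v m) ⊆ C :=
      fun {m} hm => hv' m hm
    obtain ⟨w, hw⟩ := exists_finCode ((finCode_finite u).biUnion fun m _ => finCode_finite (v m))
    obtain ⟨k0, hk0⟩ := (mem_ceSet_iff _ _).1 hu
    have : ∀ m, ∃ k, m ∈ finCode u → E j k (Nat.pair m (v m)) := fun m => by
      by_cases hm : m ∈ finCode u
      · obtain ⟨k, hk⟩ := (mem_ceSet_iff _ _).1 (hv hm).1
        exact ⟨k, fun _ => hk⟩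
      · exact ⟨0, fun h => absurd h hm⟩
    choose κ hκ using this
    let k := k0 + u + 1 + ∑ m ∈ Finset.range u, (κ m + v m)
    have hle : ∀ m < u, κ m + v m ≤ ∑ m ∈ Finset.range u, (κ m + v m) := fun m hm =>
      Finset.single_le_sum (f := fun m => κ m + v m) (fun _ _ => Nat.zero_le _) (Finset.mem_range.2 hm)
    refine ⟨w, ⟨k, u, by omega, evaln_isSome_mono (by omega) hk0, fun m hm hmu => ?_⟩, ?_⟩
    · have := hle m hm
      refine ⟨v m, ?_, evaln_isSome_mono ?_ (hκ m hmu), ?_⟩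
      · show v m < k
        omega
      · show κ m ≤ k
        omega
      · rw [hsubiff, hw]
        exact Set.subset_biUnion_of_mem (u := fun m => finCode (v m)) hmu
    · rw [hw]
      exact Set.iUnion₂_subset fun m hm => (hv hm).2
  · rintro ⟨w, ⟨k, u, -, hu, hM⟩, hw⟩
    refine ⟨u, (mem_ceSet_iff _ _).2 ⟨k, hu⟩, fun m hm => ?_⟩
    obtain ⟨v, -, hv, hvw⟩ := hM m (testBit_lt hm) hm
    exact ⟨v, (mem_ceSet_iff _ _).2 ⟨k, hv⟩, ((hsubiff _ _).1 hvw).trans hw⟩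

theorem mem_eJoin_even {A B : Set ℕ} {n : ℕ} : 2 * n ∈ eJoin A B ↔ n ∈ A := by
  simp only [eJoin, Set.mem_ofPred_eq]
  constructor
  · rintro (⟨m, hm, h⟩ | ⟨m, hm, h⟩)
    · obtain rfl : n = m := by omega
      exact hm
    · omega
  · exact fun h => Or.inl ⟨n, h, rfl⟩

theorem mem_eJoin_odd {A B : Set ℕ} {n : ℕ} : 2 * n + 1 ∈ eJoin A B ↔ n ∈ B := by
  simp only [eJoin, Set.mem_ofPred_eq]
  constructor
  · rintro (⟨m, hm, h⟩ | ⟨m, hm, h⟩)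
    · omega
    · obtain rfl : n = m := by omega
      exact hm
  · exact fun h => Or.inr ⟨n, h, rfl⟩

theorem ELe_join_left (A B : Set ℕ) : ELe A (eJoin A B) :=
  ELe.of_map (fun n => 2 * n) (Primrec.nat_mul.comp (Primrec.const 2) Primrec.id)
    fun _ => mem_eJoin_even.symm

theorem ELe_join_right (A B : Set ℕ) : ELe B (eJoin A B) :=
  ELe.of_map (fun n => 2 * n + 1)
    (Primrec.succ.comp (Primrec.nat_mul.comp (Primrec.const 2) Primrec.id))
    fun _ => mem_eJoin_odd.symm

theorem ELe_join_cofinite (A : Set ℕ) (N : Finset ℕ) : ELe (eJoin A (↑N : Set ℕ)ᶜ) A := by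
  have hev : PrimrecPred fun n : ℕ => n % 2 = 0 :=
    Primrec.eq.comp (Primrec.nat_mod.comp Primrec.id (Primrec.const 2)) (Primrec.const 0)
  have hhalf : Primrec fun n : ℕ => n / 2 := Primrec.nat_div.comp Primrec.id (Primrec.const 2)
  obtain ⟨c, hc⟩ := exists_finCode N.finite_toSet
  have hP : PrimrecPred fun n : ℕ => n % 2 = 0 ∨ ¬ (Nat.testBit c (n / 2) = true) :=
    hev.or (PrimrecPred.not (primrec_testBit.comp (Primrec.const c) hhalf))
  obtain ⟨i, hi⟩ := exists_eOp_of_map _ (fun n => if n % 2 = 0 then 2 ^ (n / 2) else 0) hP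
    (Primrec.ite hev (primrec_pow2.comp hhalf) (Primrec.const 0))
  refine ⟨i, ?_⟩
  unfold ELeVia
  rw [hi, ← hc]
  ext n
  obtain ⟨m, rfl | rfl⟩ := Nat.even_or_odd' n
  · simp [mem_eJoin_even, finCode_two_pow]
  · have h1 : (2 * m + 1) % 2 = 1 := by omega
    have h2 : (2 * m + 1) / 2 = m := by omega
    simp [mem_eJoin_odd, finCode_zero, h1, h2]
    simp [finCode]

/-! ### Measurability helpers -/

theorem measurable_eOp {α : Type*} [MeasurableSpace α] {f : α → Set ℕ} (hf : Measurable f) (i : ℕ) :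
    Measurable fun a => eOp i (f a) := by
  rw [measurable_set_iff] at *
  intro n
  have : (fun x => n ∈ eOp i (f x)) =
      fun x => ∃ u : ℕ, Nat.pair n u ∈ ceSet i ∧ ∀ m : ℕ, m ∈ finCode u → m ∈ f x := rfl
  rw [this]
  refine Measurable.exists fun u => Measurable.and measurable_const ?_
  exact Measurable.forall fun m => Measurable.imp measurable_const (hf m)

theorem measurable_eJoin {α : Type*} [MeasurableSpace α] {f g : α → Set ℕ} (hf : Measurable f)
    (hg : Measurable g) : Measurable fun a => eJoin (f a) (g a) := by
  rw [measurable_set_iff] at *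
  intro n
  obtain ⟨m, rfl | rfl⟩ := Nat.even_or_odd' n
  · simpa only [mem_eJoin_even] using hf m
  · simpa only [mem_eJoin_odd] using hg m

theorem measurable_seteq {α : Type*} [MeasurableSpace α] {f g : α → Set ℕ} (hf : Measurable f)
    (hg : Measurable g) : Measurable fun a => f a = g a := by
  rw [measurable_set_iff] at *
  simp only [Set.ext_iff]
  exact Measurable.forall fun m => Measurable.iff (hf m) (hg m)

/-- The total set `B ⊕ Bᶜ`. -/
def hat (B : Set ℕ) : Set ℕ := eJoin B Bᶜ

/-- The left half of a set. -/
def half (S : Set ℕ) : Set ℕ := {n | 2 * n ∈ S}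

theorem half_hat (B : Set ℕ) : half (hat B) = B := by
  ext n; exact mem_eJoin_even

theorem measurable_hat {α : Type*} [MeasurableSpace α] {f : α → Set ℕ} (hf : Measurable f) :
    Measurable fun a => hat (f a) := by
  refine measurable_eJoin hf ?_
  rw [measurable_set_iff] at *
  exact fun n => Measurable.not (hf n)

theorem measurable_half {α : Type*} [MeasurableSpace α] {f : α → Set ℕ} (hf : Measurable f) :
    Measurable fun a => half (f a) := by
  rw [measurable_set_iff] at *
  exact fun n => hf (2 * n)

/-- The `i`-th reduction between total sets. -/
def psi (i : ℕ) (B : Set ℕ) : Set ℕ := half (eOp i (hat B))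

theorem measurable_psi (i : ℕ) : Measurable (psi i) :=
  measurable_half (measurable_eOp (measurable_hat measurable_id) i)

/-- The operator `Γ_e(B ⊕ Bᶜ ⊕ S)`. -/
def GG (e : ℕ) (B S : Set ℕ) : Set ℕ := eOp e (eJoin (hat B) S)

theorem eOp_mono (e : ℕ) {S T : Set ℕ} (h : S ⊆ T) : eOp e S ⊆ eOp e T :=
  fun _ ⟨u, hu, hs⟩ => ⟨u, hu, hs.trans h⟩

theorem eJoin_mono (Z : Set ℕ) {S T : Set ℕ} (h : S ⊆ T) : eJoin Z S ⊆ eJoin Z T := by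
  rintro n (hn | ⟨m, hm, rfl⟩)
  · exact Or.inl hn
  · exact Or.inr ⟨m, h hm, rfl⟩

theorem GG_mono (e : ℕ) (B : Set ℕ) {S T : Set ℕ} (h : S ⊆ T) : GG e B S ⊆ GG e B T :=
  eOp_mono e (eJoin_mono _ h)

theorem GG_finite {e : ℕ} {B S : Set ℕ} {x : ℕ} (hx : x ∈ GG e B S) :
    ∃ F : Finset ℕ, (F : Set ℕ) ⊆ S ∧ x ∈ GG e B F := by
  obtain ⟨u, hu, hs⟩ := hx
  have hfin : {m | 2 * m + 1 ∈ finCode u}.Finite :=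
    (Set.finite_lt_nat u).subset fun m hm => by
      have := testBit_lt hm
      show m < u
      omega
  refine ⟨hfin.toFinset, fun m hm => ?_, u, hu, fun n hn => ?_⟩
  · have hm' : 2 * m + 1 ∈ finCode u := by simpa using hm
    exact mem_eJoin_odd.1 (hs hm')
  · obtain ⟨m, rfl | rfl⟩ := Nat.even_or_odd' n
    · exact mem_eJoin_even.2 (mem_eJoin_even.1 (hs hn))
    · exact mem_eJoin_odd.2 (by simpa using hn)

theorem measurable_GG (e : ℕ) (S : Set ℕ) (x : ℕ) : Measurable fun B => x ∈ GG e B S :=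
  measurable_set_iff.1
    (measurable_eOp (measurable_eJoin (measurable_hat measurable_id) measurable_const) e) x

/-! ### Functions into countable types with measurable fibres -/

/-- All fibres of `f` are measurable. -/
def DM {κ : Type} (f : Set ℕ → κ) : Prop := ∀ t, Measurable fun B => f B = t

theorem DM.bind {ι κ : Type} [Countable ι] {σ : Set ℕ → ι} (hσ : DM σ) {g : ι → Set ℕ → κ}
    (hg : ∀ t, DM (g t)) : DM fun B => g (σ B) B := by
  intro t
  have : (fun B => g (σ B) B = t) = fun B => ∃ s, σ B = s ∧ g s B = t := by
    ext B; simp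
  rw [this]
  exact Measurable.exists fun s => (hσ s).and (hg s t)

theorem DM.const {κ : Type} (c : κ) : DM fun _ => c := fun _ => measurable_const

theorem DM.map {ι κ : Type} [Countable ι] {σ : Set ℕ → ι} (hσ : DM σ) (h : ι → κ) :
    DM fun B => h (σ B) := hσ.bind fun t => DM.const (h t)

theorem DM.precomp {κ : Type} {f : Set ℕ → κ} (hf : DM f) {p : Set ℕ → Set ℕ}
    (hp : Measurable p) : DM fun B => f (p B) := fun t => (hf t).comp hp

theorem DM.ite {κ : Type} {f g : Set ℕ → κ} (hf : DM f) (hg : DM g) {p : Set ℕ → Prop}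
    [∀ B, Decidable (p B)] (hp : Measurable p) : DM fun B => if p B then f B else g B := by
  intro t
  have : (fun B => (if p B then f B else g B) = t) =
      fun B => (p B ∧ f B = t) ∨ (¬ p B ∧ g B = t) := by
    ext B; by_cases h : p B <;> simp [h]
  rw [this]
  exact (hp.and (hf t)).or (hp.not.and (hg t))

/-- Least witness, if any. -/
noncomputable def pick (P : ℕ → Prop) : Option ℕ := if h : ∃ k, P k then some (Nat.find h) else none

theorem pick_some {P : ℕ → Prop} {k : ℕ} (h : pick P = some k) : P k := by
  unfold pick at h
  split_ifs at h with h'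
  rw [← Option.some.inj h]
  exact Nat.find_spec h'

theorem pick_none {P : ℕ → Prop} (h : pick P = none) : ∀ k, ¬ P k := by
  unfold pick at h
  split_ifs at h with h'
  exact not_exists.1 h'

theorem pick_eq_some_iff {P : ℕ → Prop} {k : ℕ} : pick P = some k ↔ P k ∧ ∀ l < k, ¬ P l := by
  constructor
  · intro h
    refine ⟨pick_some h, ?_⟩
    unfold pick at h
    split_ifs at h with h'
    rw [← Option.some.inj h]
    exact fun l hl => Nat.find_min h' hl
  · rintro ⟨h, hl⟩
    unfold pick
    rw [dif_pos ⟨k, h⟩]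
    congr 1
    rw [Nat.find_eq_iff]
    exact ⟨h, hl⟩

theorem DM_pick {P : ℕ → Set ℕ → Prop} (hP : ∀ k, Measurable (P k)) :
    DM fun B => pick fun k => P k B := by
  rintro (_ | k)
  · have : (fun B => (pick fun k => P k B) = none) = fun B => ∀ k, ¬ P k B := by
      ext B
      refine ⟨pick_none, fun h => ?_⟩
      unfold pick
      rw [dif_neg (not_exists.2 h)]
    rw [this]
    exact Measurable.forall fun k => (hP k).not
  · simp only [pick_eq_some_iff]
    exact (hP k).and (Measurable.forall fun l => Measurable.forall fun _ => (hP l).not)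

/-! ### The construction -/

/-- Conditions: finite positive and negative information. -/
abbrev St := Finset ℕ × Finset ℕ

/-- An enumeration of finite sets with a number. -/
noncomputable def en : ℕ → Finset ℕ × ℕ := Classical.choose (exists_surjective_nat (Finset ℕ × ℕ))

theorem en_surj : Function.Surjective en :=
  Classical.choose_spec (exists_surjective_nat (Finset ℕ × ℕ))

/-- The joint action for the pair requirement. -/
noncomputable def actPair (e : ℕ) (p N : Finset ℕ) (W : Set ℕ) : Option (Finset ℕ × ℕ) :=
  (pick fun k => Disjoint (en k).1 N ∧ (en k).2 ∉ p ∧ (en k).2 ∈ GG e W (en k).1).map en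

/-- The action for quasi-minimality. -/
noncomputable def actGen (e : ℕ) (N : Finset ℕ) (B : Set ℕ) : Option (Finset ℕ × ℕ) :=
  (pick fun k => Disjoint (en k).1 N ∧ 2 * (en k).2 ∈ GG e B (en k).1 ∧
    2 * (en k).2 + 1 ∈ GG e B (en k).1).map en

theorem actPair_some {e : ℕ} {p N : Finset ℕ} {W : Set ℕ} {c : Finset ℕ × ℕ}
    (h : actPair e p N W = some c) : Disjoint c.1 N ∧ c.2 ∉ p ∧ c.2 ∈ GG e W c.1 := by
  obtain ⟨k, hk, rfl⟩ := Option.map_eq_some_iff.1 h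
  exact pick_some hk

theorem actPair_none {e : ℕ} {p N : Finset ℕ} {W : Set ℕ}
    (h : actPair e p N W = none) (F : Finset ℕ) (x : ℕ) (hF : Disjoint F N) (hx : x ∈ GG e W F) :
    x ∈ p := by
  obtain ⟨k, hk⟩ := en_surj (F, x)
  have := pick_none (Option.map_eq_none_iff.1 h) k
  rw [hk] at this
  by_contra hxp
  exact this ⟨hF, hxp, hx⟩

theorem actGen_some {e : ℕ} {N : Finset ℕ} {B : Set ℕ} {c : Finset ℕ × ℕ}
    (h : actGen e N B = some c) :
    Disjoint c.1 N ∧ 2 * c.2 ∈ GG e B c.1 ∧ 2 * c.2 + 1 ∈ GG e B c.1 := by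
  obtain ⟨k, hk, rfl⟩ := Option.map_eq_some_iff.1 h
  exact pick_some hk

theorem actGen_none {e : ℕ} {N : Finset ℕ} {B : Set ℕ}
    (h : actGen e N B = none) (F : Finset ℕ) (x : ℕ) (hF : Disjoint F N)
    (hx : 2 * x ∈ GG e B F) (hx' : 2 * x + 1 ∈ GG e B F) : False := by
  obtain ⟨k, hk⟩ := en_surj (F, x)
  have := pick_none (Option.map_eq_none_iff.1 h) k
  rw [hk] at this
  exact this ⟨hF, hx, hx'⟩

theorem DM_actPair (e : ℕ) (p N : Finset ℕ) : DM (actPair e p N) := by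
  refine DM.map (DM_pick fun k => ?_) (Option.map en)
  exact measurable_const.and (measurable_const.and (measurable_GG _ _ _))

theorem DM_actGen (e : ℕ) (N : Finset ℕ) : DM (actGen e N) := by
  refine DM.map (DM_pick fun k => ?_) (Option.map en)
  exact measurable_const.and ((measurable_GG _ _ _).and (measurable_GG _ _ _))

/-- Add negative information. -/
def updNeg (s : St) : Option (Finset ℕ × ℕ) → St
  | none => s
  | some c => (s.1, insert c.2 s.2)

/-- Add positive information. -/
def updPos (s : St) : Option (Finset ℕ × ℕ) → St
  | none => s
  | some c => (s.1 ∪ c.1, s.2)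

/-- Requirements. -/
abbrev Req := (ℕ × ℕ × ℕ × ℕ × Bool) ⊕ ℕ ⊕ ℕ

/-- Pair step. -/
noncomputable def opPair (t : ℕ × ℕ × ℕ × ℕ × Bool) (σ : Set ℕ → St) (B : Set ℕ) : St :=
  if (t.2.2.2.1 ∈ B ↔ t.2.2.2.2 = true) then
    if psi t.2.1 (psi t.1 B) = B ∧ ¬ (t.2.2.2.1 ∈ psi t.1 B ↔ t.2.2.2.2 = true) then
      updNeg (σ B) (actPair t.2.2.1 (σ B).1 (σ (psi t.1 B)).2 (psi t.1 B))
    else σ B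
  else
    if psi t.1 (psi t.2.1 B) = B ∧ (t.2.2.2.1 ∈ psi t.2.1 B ↔ t.2.2.2.2 = true) then
      updPos (σ B) (actPair t.2.2.1 (σ (psi t.2.1 B)).1 (σ B).2 B)
    else σ B

/-- One step of the construction. -/
noncomputable def op : Req → (Set ℕ → St) → Set ℕ → St
  | .inl t, σ, B => opPair t σ B
  | .inr (.inl e), σ, B => updPos (σ B) (actGen e (σ B).2 B)
  | .inr (.inr m), σ, B => (insert (m + (σ B).2.sup id + 1) (σ B).1, (σ B).2)

theorem le_updNeg (s : St) (o) : s ≤ updNeg s o := by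
  cases o with
  | none => exact le_rfl
  | some c => exact ⟨le_rfl, Finset.subset_insert _ _⟩

theorem le_updPos (s : St) (o) : s ≤ updPos s o := by
  cases o with
  | none => exact le_rfl
  | some c => exact ⟨Finset.subset_union_left, le_rfl⟩

theorem le_op (t : Req) (σ : Set ℕ → St) (B : Set ℕ) : σ B ≤ op t σ B := by
  rcases t with t | e | m
  · simp only [op, opPair]
    split_ifs
    · exact le_updNeg _ _
    · exact le_rfl
    · exact le_updPos _ _
    · exact le_rfl
  · exact le_updPos _ _
  · exact ⟨Finset.subset_insert _ _, le_rfl⟩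

theorem disj_op (t : Req) (σ : Set ℕ → St) (B : Set ℕ) (h : Disjoint (σ B).1 (σ B).2) :
    Disjoint (op t σ B).1 (op t σ B).2 := by
  rcases t with t | e | m
  · simp only [op, opPair]
    split_ifs
    · rcases hc : actPair t.2.2.1 (σ B).1 (σ (psi t.1 B)).2 (psi t.1 B) with _ | c
      · exact h
      · simpa [updNeg] using ⟨(actPair_some hc).2.1, h⟩
    · exact h
    · rcases hc : actPair t.2.2.1 (σ (psi t.2.1 B)).1 (σ B).2 B with _ | c
      · exact h
      · simpa [updPos, Finset.disjoint_union_left] using ⟨h, (actPair_some hc).1⟩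
    · exact h
  · simp only [op]
    rcases hc : actGen e (σ B).2 B with _ | c
    · exact h
    · simpa [updPos, Finset.disjoint_union_left] using ⟨h, (actGen_some hc).1⟩
  · simp only [op, Finset.disjoint_insert_left]
    refine ⟨fun hm => ?_, h⟩
    have := Finset.le_sup (f := id) hm
    simp only [id] at this
    omega

theorem DM_op (t : Req) (σ : Set ℕ → St) (hσ : DM σ) : DM (op t σ) := by
  rcases t with ⟨i, j, e, n, b⟩ | e | m
  · have hi := measurable_psi i
    have hj := measurable_psi j
    have m1 : Measurable fun B : Set ℕ => (n ∈ B ↔ b = true) :=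
      (measurable_set_mem n).iff measurable_const
    change DM fun B => if (n ∈ B ↔ b = true) then
        (if psi j (psi i B) = B ∧ ¬ (n ∈ psi i B ↔ b = true) then
          updNeg (σ B) (actPair e (σ B).1 (σ (psi i B)).2 (psi i B)) else σ B)
      else (if psi i (psi j B) = B ∧ (n ∈ psi j B ↔ b = true) then
          updPos (σ B) (actPair e (σ (psi j B)).1 (σ B).2 B) else σ B)
    refine DM.ite (DM.ite ?_ hσ ?_) (DM.ite ?_ hσ ?_) m1
    · refine DM.bind (g := fun s B => updNeg s (actPair e s.1 (σ (psi i B)).2 (psi i B))) hσ fun s => ?_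
      refine DM.map (h := updNeg s) ?_
      exact DM.precomp (f := fun W => actPair e s.1 (σ W).2 W)
        (DM.bind (g := fun t W => actPair e s.1 t.2 W) hσ fun t => DM_actPair _ _ _) hi
    · exact (measurable_seteq (hj.comp hi) measurable_id).and (m1.comp hi).not
    · refine DM.bind (g := fun s B => updPos s (actPair e (σ (psi j B)).1 s.2 B)) hσ fun s => ?_
      refine DM.map (h := updPos s) ?_
      exact DM.bind (g := fun t B => actPair e t.1 s.2 B) (hσ.precomp hj) fun t => DM_actPair _ _ _
    · exact (measurable_seteq (hi.comp hj) measurable_id).and (m1.comp hj)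
  · exact DM.bind (g := fun s B => updPos s (actGen e s.2 B)) hσ fun s =>
      DM.map (DM_actGen _ _) (updPos s)
  · exact DM.map hσ fun s => (insert (m + s.2.sup id + 1) s.1, s.2)

/-- An enumeration of the requirements. -/
noncomputable def tasks : ℕ → Req := Classical.choose (exists_surjective_nat Req)

theorem tasks_surj : Function.Surjective tasks :=
  Classical.choose_spec (exists_surjective_nat Req)

/-- The stages of the construction. -/
noncomputable def stage : ℕ → Set ℕ → St
  | 0 => fun _ => (∅, ∅)
  | s + 1 => op (tasks s) (stage s)

theorem DM_stage (s : ℕ) : DM (stage s) := by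
  induction s with
  | zero => exact DM.const _
  | succ s ih => exact DM_op _ _ ih

theorem stage_mono (B : Set ℕ) : Monotone fun s => stage s B :=
  monotone_nat_of_le_succ fun s => le_op (tasks s) (stage s) B

theorem stage_disj (B : Set ℕ) (s : ℕ) : Disjoint (stage s B).1 (stage s B).2 := by
  induction s with
  | zero => simp [stage]
  | succ s ih => exact disj_op _ _ _ ih

/-- The marker function. -/
def VV (B : Set ℕ) : Set ℕ := {n | ∃ s, n ∈ (stage s B).1}

theorem measurable_VV : Measurable VV := by
  rw [measurable_set_iff]
  intro n
  refine Measurable.exists fun s => ?_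
  have : (fun B => n ∈ (stage s B).1) = fun B => ∃ t : St, n ∈ t.1 ∧ stage s B = t := by
    ext B; simp
  rw [this]
  exact Measurable.exists fun t => measurable_const.and (DM_stage s t)

theorem pos_subset_VV (B : Set ℕ) (s : ℕ) : ((stage s B).1 : Set ℕ) ⊆ VV B := fun _ hn => ⟨s, hn⟩

theorem neg_VV {B : Set ℕ} {s x : ℕ} (hx : x ∈ (stage s B).2) : x ∉ VV B := by
  rintro ⟨r, hr⟩
  have h1 := (stage_mono B (le_max_left r s)).1 hr
  have h2 := (stage_mono B (le_max_right r s)).2 hx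
  exact Finset.disjoint_left.1 (stage_disj B _) h1 h2

theorem disjoint_neg {B : Set ℕ} {s : ℕ} {F : Finset ℕ} (hF : (F : Set ℕ) ⊆ VV B) :
    Disjoint F (stage s B).2 :=
  Finset.disjoint_left.2 fun _ hx hx' => neg_VV hx' (hF hx)

theorem VV_infinite (B : Set ℕ) : (VV B).Infinite := by
  rw [Set.infinite_iff_exists_gt]
  intro m
  obtain ⟨s, hs⟩ := tasks_surj (.inr (.inr m))
  refine ⟨m + (stage s B).2.sup id + 1, ⟨s + 1, ?_⟩, by omega⟩
  simp [stage, hs, op]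

theorem VV_ne {U W : Set ℕ} (hne : U ≠ W) {i j : ℕ} (hi : psi i U = W) (hj : psi j W = U) (e : ℕ) :
    VV U ≠ GG e W (VV W) := by
  intro heq
  obtain ⟨n, hn⟩ : ∃ n, ¬ (n ∈ U ↔ n ∈ W) := by
    by_contra h
    push Not at h
    exact hne (Set.ext h)
  let b : Bool := decide (n ∈ U)
  have hbU : n ∈ U ↔ b = true := by simp [b]
  have hbW : ¬ (n ∈ W ↔ b = true) := by rw [← hbU]; tauto
  obtain ⟨s, hs⟩ := tasks_surj (.inl (i, j, e, n, b))
  have hU : stage (s + 1) U = updNeg (stage s U) (actPair e (stage s U).1 (stage s W).2 W) := by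
    simp only [stage, hs, op, opPair]
    rw [if_pos hbU, hi, if_pos ⟨hj, hbW⟩]
  have hW : stage (s + 1) W = updPos (stage s W) (actPair e (stage s U).1 (stage s W).2 W) := by
    simp only [stage, hs, op, opPair]
    rw [if_neg hbW, hj, if_pos ⟨hi, hbU⟩]
  rcases hc : actPair e (stage s U).1 (stage s W).2 W with _ | c
  · apply VV_infinite U
    apply (stage s U).1.finite_toSet.subset
    intro x hx
    rw [heq] at hx
    obtain ⟨F, hF, hxF⟩ := GG_finite hx
    exact actPair_none hc F x (disjoint_neg hF) hxF
  · rw [hc] at hU hW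
    have h1 : c.2 ∉ VV U := neg_VV (s := s + 1) (by rw [hU]; simp [updNeg])
    apply h1
    rw [heq]
    refine GG_mono e W (fun x hx => ?_) (actPair_some hc).2.2
    apply pos_subset_VV W (s + 1)
    rw [hW]
    simp only [updPos, Finset.coe_union]
    exact Or.inr hx

theorem VV_gen (B : Set ℕ) (e : ℕ) :
    (∃ x, 2 * x ∈ GG e B (VV B) ∧ 2 * x + 1 ∈ GG e B (VV B)) ∨
    ∃ N : Finset ℕ, VV B ⊆ (↑N : Set ℕ)ᶜ ∧
      ∀ x, 2 * x ∈ GG e B (↑N : Set ℕ)ᶜ → 2 * x + 1 ∉ GG e B (↑N : Set ℕ)ᶜ := by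
  obtain ⟨s, hs⟩ := tasks_surj (.inr (.inl e))
  have hB : stage (s + 1) B = updPos (stage s B) (actGen e (stage s B).2 B) := by
    simp only [stage, hs, op]
  rcases hc : actGen e (stage s B).2 B with _ | c
  · right
    refine ⟨(stage s B).2, fun x hx hx' => neg_VV hx' hx, fun x h1 h2 => ?_⟩
    obtain ⟨F, hF, hxF⟩ := GG_finite h1
    obtain ⟨F', hF', hxF'⟩ := GG_finite h2
    refine actGen_none hc (F ∪ F') x ?_ (GG_mono e B (by simp) hxF) (GG_mono e B (by simp) hxF')
    rw [Finset.disjoint_union_left]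
    exact ⟨Finset.disjoint_left.2 fun y hy => hF hy, Finset.disjoint_left.2 fun y hy => hF' hy⟩
  · left
    rw [hc] at hB
    have hsub : (c.1 : Set ℕ) ⊆ VV B := by
      intro x hx
      apply pos_subset_VV B (s + 1)
      rw [hB]
      simp only [updPos, Finset.coe_union]
      exact Or.inr hx
    exact ⟨c.2, GG_mono e B hsub (actGen_some hc).2.1, GG_mono e B hsub (actGen_some hc).2.2⟩

/-! ### The invariant -/

/-- `B` is marked in `X`. -/
def Mark (X B : Set ℕ) : Prop :=
  ELe (hat B) X ∧ ELe (VV B) X ∧ ∀ T, ELe (hat T) X → ELe (hat T) (hat B)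

/-- The degree-invariant function with cofinal fibres. -/
def gg (X : Set ℕ) : Set ℕ := {n | ∃ B, Mark X B ∧ 2 * n ∈ B}

theorem Mark_congr {X X' : Set ℕ} (h : ELe X X') (h' : ELe X' X) {B : Set ℕ} (hB : Mark X B) :
    Mark X' B :=
  ⟨hB.1.trans h, hB.2.1.trans h, fun T hT => hB.2.2 T (hT.trans h')⟩

theorem gg_congr {X X' : Set ℕ} (h : ELe X X') (h' : ELe X' X) : gg X = gg X' := by
  ext n
  exact ⟨fun ⟨B, hB, hn⟩ => ⟨B, Mark_congr h h' hB, hn⟩,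
    fun ⟨B, hB, hn⟩ => ⟨B, Mark_congr h' h hB, hn⟩⟩

theorem measurable_gg : Measurable gg := by
  rw [measurable_set_iff]
  intro n
  have : (fun X => n ∈ gg X) = fun X => ∃ i : ℕ, (eOp i X = hat (half (eOp i X)) ∧
      (∃ j : ℕ, VV (half (eOp i X)) = eOp j X) ∧
      ∀ k : ℕ, eOp k X = hat (half (eOp k X)) → ∃ l : ℕ, eOp k X = eOp l (eOp i X)) ∧
      2 * n ∈ half (eOp i X) := by
    ext X
    constructor
    · rintro ⟨B, ⟨⟨i, hi⟩, ⟨j, hj⟩, hT⟩, hn⟩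
      unfold ELeVia at hi hj
      have hB : half (eOp i X) = B := by rw [← hi, half_hat]
      refine ⟨i, ⟨by rw [hB, hi], ⟨j, by rw [hB, hj]⟩, fun k hk => ?_⟩, by rwa [hB]⟩
      obtain ⟨l, hl⟩ := hT (half (eOp k X)) ⟨k, hk.symm⟩
      unfold ELeVia at hl
      exact ⟨l, by rw [hk, hl, hi]⟩
    · rintro ⟨i, ⟨hi, ⟨j, hj⟩, hT⟩, hn⟩
      refine ⟨half (eOp i X), ⟨⟨i, hi.symm⟩, ⟨j, hj⟩, ?_⟩, hn⟩
      rintro T ⟨k, hk⟩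
      unfold ELeVia at hk
      obtain ⟨l, hl⟩ := hT k (by rw [← hk, half_hat])
      exact ⟨l, by unfold ELeVia; rw [hk, ← hi, hl]⟩
  rw [this]
  have hE : ∀ i, Measurable (eOp i) := fun i => measurable_eOp measurable_id i
  have hH : ∀ i, Measurable fun X => half (eOp i X) := fun i => measurable_half (hE i)
  have hHH : ∀ i, Measurable fun X => eOp i X = hat (half (eOp i X)) := fun i =>
    measurable_seteq (hE i) (measurable_hat (hH i))
  refine Measurable.exists fun i => Measurable.and ((hHH i).and (Measurable.and ?_ ?_)) ?_
  · exact Measurable.exists fun j => measurable_seteq (measurable_VV.comp (hH i)) (hE j)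
  · exact Measurable.forall fun k => (hHH k).imp (Measurable.exists fun l =>
      measurable_seteq (hE k) (measurable_eOp (hE i) l))
  · exact measurable_set_iff.1 (hH i) (2 * n)

theorem hat_not_both {T : Set ℕ} {x : ℕ} (h : 2 * x ∈ hat T) (h' : 2 * x + 1 ∈ hat T) : False :=
  mem_eJoin_odd.1 h' (mem_eJoin_even.1 h)

theorem hat_le_of_le_join {B T : Set ℕ} (h : ELe (hat T) (eJoin (hat B) (VV B))) :
    ELe (hat T) (hat B) := by
  obtain ⟨e, he⟩ := h
  have he : hat T = GG e B (VV B) := he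
  rcases VV_gen B e with ⟨x, h1, h2⟩ | ⟨N, hN, hx⟩
  · rw [← he] at h1 h2
    exact (hat_not_both h1 h2).elim
  · have hsub : hat T ⊆ GG e B (↑N : Set ℕ)ᶜ := by
      rw [he]; exact GG_mono e B hN
    have : hat T = GG e B (↑N : Set ℕ)ᶜ := by
      refine hsub.antisymm fun n hn => ?_
      obtain ⟨m, rfl | rfl⟩ := Nat.even_or_odd' n
      · refine mem_eJoin_even.2 ?_
        by_contra hm
        exact hx m hn (hsub (mem_eJoin_odd.2 hm))
      · refine mem_eJoin_odd.2 fun hm => ?_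
        exact hx m (hsub (mem_eJoin_even.2 hm)) hn
    exact ELe.trans ⟨e, this⟩ (ELe_join_cofinite _ _)

theorem Mark_iff {B U : Set ℕ} : Mark (eJoin (hat B) (VV B)) U ↔ U = B := by
  constructor
  · rintro ⟨h1, ⟨e, he⟩, h3⟩
    by_contra hne
    obtain ⟨j, hj⟩ := hat_le_of_le_join h1
    obtain ⟨i, hi⟩ := h3 B (ELe_join_left _ _)
    unfold ELeVia at hi hj
    refine VV_ne hne (i := i) (j := j) ?_ ?_ e he
    · rw [psi, ← hi, half_hat]
    · rw [psi, ← hj, half_hat]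
  · rintro rfl
    exact ⟨ELe_join_left _ _, ELe_join_right _ _, fun T hT => hat_le_of_le_join hT⟩

/-- For every Borel `F` there is a Borel uniformly e-invariant `f` such that
for every `A`, the set of degrees on which `f` takes the value `F(A)` is
cofinal in the enumeration degrees. -/
theorem exists_uniform_with_cofinal_fibers (F : Set ℕ → Set ℕ) (hF : BorelFun F) :
    ∃ f : Set ℕ → Set ℕ, BorelFun f ∧ UniformlyEInvariant f ∧
      ∀ A Y : Set ℕ, ∃ X : Set ℕ, ELe Y X ∧ f X = F A := by

  refine ⟨fun X => F (gg X), hF.comp measurable_gg, ?_, fun A Y => ?_⟩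
  · obtain ⟨i, hi⟩ := exists_eOp_id
    refine ⟨fun _ => Nat.pair i i, fun A _ B _ a b hab => ?_⟩
    have : gg A = gg B := gg_congr ⟨a, hab.1⟩ ⟨b, hab.2⟩
    simp only [Nat.unpair_pair, this]
    exact ⟨(hi _).symm, (hi _).symm⟩
  · refine ⟨eJoin (hat (eJoin A Y)) (VV (eJoin A Y)), ?_, ?_⟩
    · exact (ELe_join_right A Y).trans ((ELe_join_left _ _).trans (ELe_join_left _ _))
    · have : gg (eJoin (hat (eJoin A Y)) (VV (eJoin A Y))) = A := by
        ext n
        simp only [gg, Mark_iff, Set.mem_ofPred_eq, exists_eq_left, mem_eJoin_even]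
      simp only [this]
end

section
/- Let X ⊆ P(ℕ) be closed under enumeration equivalence. If f : X → P(ℕ) is uniformly e-invariant, then f has a computable uniformity function. -/
open Classical

namespace CU

open Nat.Partrec (Code)

/-- Sigma-one predicates presented by monotone primitive recursive stages. -/
def Sig {α : Type} [Primcodable α] (p : α → Prop) : Prop :=
  ∃ R : α → ℕ → Prop, PrimrecRel R ∧ (∀ a s t, s ≤ t → R a s → R a t) ∧ ∀ a, p a ↔ ∃ s, R a s

section
variable {α β : Type} [Primcodable α] [Primcodable β]

theorem ex_lt {R : ℕ → α → Prop} (hf : PrimrecRel R) :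
    PrimrecRel fun (n : ℕ) y => ∃ x < n, R x y :=
  (hf.exists_mem_list.comp (Primrec.list_range.comp Primrec.fst) Primrec.snd).of_eq (by simp)

theorem fa_lt {R : ℕ → α → Prop} (hf : PrimrecRel R) :
    PrimrecRel fun (n : ℕ) y => ∀ x < n, R x y :=
  (hf.forall_mem_list.comp (Primrec.list_range.comp Primrec.fst) Primrec.snd).of_eq (by simp)

theorem Sig.prim {p : α → Prop} (h : PrimrecPred p) : Sig p :=
  ⟨fun a _ => p a, h.comp Primrec.fst, fun _ _ _ _ h => h, fun _ => by simp⟩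

theorem Sig.comp {p : β → Prop} (h : Sig p) {g : α → β} (hg : Primrec g) :
    Sig fun a => p (g a) := by
  obtain ⟨R, h1, h2, h3⟩ := h
  exact ⟨fun a s => R (g a) s, h1.comp (hg.comp Primrec.fst) Primrec.snd,
    fun a => h2 (g a), fun a => h3 (g a)⟩

theorem Sig.and {p q : α → Prop} (hp : Sig p) (hq : Sig q) : Sig fun a => p a ∧ q a := by
  obtain ⟨R, h1, h2, h3⟩ := hp
  obtain ⟨S, k1, k2, k3⟩ := hq
  refine ⟨fun a s => R a s ∧ S a s, PrimrecPred.and h1 k1,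
    fun a s t hst h => ⟨h2 a s t hst h.1, k2 a s t hst h.2⟩, fun a => ?_⟩
  change (p a ∧ q a) ↔ ∃ s, R a s ∧ S a s
  rw [h3, k3]
  constructor
  · rintro ⟨⟨s, hs⟩, ⟨t, ht⟩⟩
    exact ⟨max s t, h2 a s _ (le_max_left _ _) hs, k2 a t _ (le_max_right _ _) ht⟩
  · rintro ⟨s, h, k⟩
    exact ⟨⟨s, h⟩, ⟨s, k⟩⟩

theorem Sig.or {p q : α → Prop} (hp : Sig p) (hq : Sig q) : Sig fun a => p a ∨ q a := by
  obtain ⟨R, h1, h2, h3⟩ := hp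
  obtain ⟨S, k1, k2, k3⟩ := hq
  refine ⟨fun a s => R a s ∨ S a s, PrimrecPred.or h1 k1,
    fun a s t hst h => h.imp (h2 a s t hst) (k2 a s t hst), fun a => ?_⟩
  change (p a ∨ q a) ↔ ∃ s, R a s ∨ S a s
  rw [h3, k3, exists_or]

theorem Sig.ex {p : α → ℕ → Prop} (hp : Sig fun q : α × ℕ => p q.1 q.2) :
    Sig fun a => ∃ x, p a x := by
  obtain ⟨R, h1, h2, h3⟩ := hp
  have hR : PrimrecRel fun (x : ℕ) (y : α × ℕ) => R (y.1, x) y.2 :=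
    h1.comp (Primrec.pair (Primrec.fst.comp Primrec.snd) Primrec.fst)
      (Primrec.snd.comp Primrec.snd)
  refine ⟨fun a s => ∃ x < s, R (a, x) s, ?_, ?_, ?_⟩
  · have h := ex_lt hR
    exact h.comp (f := fun z : α × ℕ => z.2) (g := fun z : α × ℕ => z) Primrec.snd Primrec.id
  · rintro a s t hst ⟨x, hx, h⟩
    exact ⟨x, hx.trans_le hst, h2 _ _ _ hst h⟩
  · intro a
    constructor
    · rintro ⟨x, hx⟩
      obtain ⟨s, hs⟩ := (h3 (a, x)).1 hx
      exact ⟨max s (x + 1), x, by omega, h2 _ _ _ (le_max_left _ _) hs⟩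
    · rintro ⟨s, x, -, h⟩
      exact ⟨x, (h3 (a, x)).2 ⟨s, h⟩⟩

theorem Sig.all_lt {p : α → ℕ → Prop} (hp : Sig fun q : α × ℕ => p q.1 q.2) {b : α → ℕ}
    (hb : Primrec b) : Sig fun a => ∀ x < b a, p a x := by
  obtain ⟨R, h1, h2, h3⟩ := hp
  have hR : PrimrecRel fun (x : ℕ) (y : α × ℕ) => R (y.1, x) y.2 :=
    h1.comp (Primrec.pair (Primrec.fst.comp Primrec.snd) Primrec.fst)
      (Primrec.snd.comp Primrec.snd)
  refine ⟨fun a s => ∀ x < b a, R (a, x) s, ?_, ?_, ?_⟩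
  · have h := fa_lt hR
    exact h.comp (f := fun z : α × ℕ => b z.1) (g := fun z : α × ℕ => z) (hb.comp Primrec.fst)
      Primrec.id
  · intro a s t hst h x hx
    exact h2 _ _ _ hst (h x hx)
  · intro a
    constructor
    · intro h
      have h' : ∀ x, ∃ s, x < b a → R (a, x) s := by
        intro x
        by_cases hx : x < b a
        · obtain ⟨s, hs⟩ := (h3 (a, x)).1 (h x hx)
          exact ⟨s, fun _ => hs⟩
        · exact ⟨0, fun h => absurd h hx⟩
      choose g hg using h'
      refine ⟨(Finset.range (b a)).sup g, fun x hx => h2 _ _ _ ?_ (hg x hx)⟩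
      exact Finset.le_sup (f := g) (Finset.mem_range.2 hx)
    · rintro ⟨s, hs⟩ x hx
      exact (h3 (a, x)).2 ⟨s, hs x hx⟩

end

theorem sig_ce : Sig fun q : ℕ × ℕ => q.2 ∈ ceSet q.1 := by
  refine ⟨fun q s => (Code.evaln s (Denumerable.ofNat Code q.1) q.2).isSome = true, ?_, ?_, ?_⟩
  · have h : Primrec fun z : (ℕ × ℕ) × ℕ =>
        (Code.evaln z.2 (Denumerable.ofNat Code z.1.1) z.1.2).isSome :=
      Primrec.option_isSome.comp (Code.primrec_evaln.comp
        (Primrec.pair (Primrec.pair Primrec.snd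
          ((Primrec.ofNat Code).comp (Primrec.fst.comp Primrec.fst)))
          (Primrec.snd.comp Primrec.fst)))
    exact Primrec.eq.comp h (Primrec.const true)
  · intro q s t hst h
    rw [Option.isSome_iff_exists] at h ⊢
    obtain ⟨x, hx⟩ := h
    exact ⟨x, Code.evaln_mono hst hx⟩
  · intro q
    simp only [ceSet, Set.mem_ofPred_eq, Part.dom_iff_mem, Option.isSome_iff_exists]
    simp only [Code.evaln_complete]
    exact exists_comm

theorem Sig.re {α : Type} [Primcodable α] {p : α → Prop} (h : Sig p) : REPred p := by
  obtain ⟨R, h1, h2, h3⟩ := h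
  have hd : Computable₂ fun a s => decide (R a s) := (PrimrecPred.decide h1).to_comp
  have hpart : Partrec fun a => Nat.rfind fun s => (Part.some (decide (R a s))) :=
    Partrec.rfind hd.partrec₂
  refine (Partrec.dom_re hpart).of_eq fun a => ?_
  rw [h3]
  refine Nat.rfind_dom.trans ⟨?_, ?_⟩
  · rintro ⟨n, h, -⟩
    exact ⟨n, of_decide_eq_true (Part.mem_some_iff.1 h).symm⟩
  · rintro ⟨n, h⟩
    exact ⟨n, Part.mem_some_iff.2 (decide_eq_true h).symm, fun _ => trivial⟩

/-- s-m-n for enumeration operators. -/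
theorem smn_op {p : ℕ → ℕ → ℕ → Prop} (h : Sig fun q : ℕ × ℕ × ℕ => p q.1 q.2.1 q.2.2) :
    ∃ s : ℕ → ℕ, Computable s ∧
      ∀ a n B, n ∈ eOp (s a) B ↔ ∃ w, p a n w ∧ finCode w ⊆ B := by
  have h' : Sig fun m : ℕ => p m.unpair.1 m.unpair.2.unpair.1 m.unpair.2.unpair.2 :=
    h.comp (g := fun m : ℕ => (m.unpair.1, m.unpair.2.unpair.1, m.unpair.2.unpair.2)) (by
      have h1 : Primrec fun m : ℕ => m.unpair.1 := Primrec.fst.comp Primrec.unpair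
      have h2 : Primrec fun m : ℕ => m.unpair.2 := Primrec.snd.comp Primrec.unpair
      exact Primrec.pair h1 (Primrec.pair (h1.comp h2) (h2.comp h2)))
  have hre := h'.re
  have hre2 : Partrec fun m : ℕ => (Part.assert
      (p m.unpair.1 m.unpair.2.unpair.1 m.unpair.2.unpair.2) fun _ => Part.some ()).map
        (fun _ => (0 : ℕ)) := Partrec.map hre (Computable.const 0).to₂
  obtain ⟨c, hc⟩ := Code.exists_code.1 (Partrec.nat_iff.1 hre2)
  refine ⟨fun a => Encodable.encode (Code.curry c a), ?_, ?_⟩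
  · exact (Primrec.encode.comp (Code.primrec₂_curry.comp (Primrec.const c) Primrec.id)).to_comp
  · intro a n B
    simp only [eOp, ceSet, Set.mem_ofPred_eq, Denumerable.ofNat_encode, Code.eval_curry, hc]
    simp [Part.assert]

theorem exists_finCode (S : Finset ℕ) : ∃ w, finCode w = S := by
  induction S using Finset.induction_on with
  | empty => exact ⟨0, by ext; simp [finCode]⟩
  | insert a S _ ih =>
    obtain ⟨w, hw⟩ := ih
    refine ⟨2 ^ a ||| w, ?_⟩
    ext x
    have := Set.ext_iff.1 hw x
    simp only [finCode, Set.mem_ofPred_eq, Finset.mem_coe] at this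
    simp [finCode, Nat.testBit_two_pow, this, eq_comm (a := a)]

theorem exists_finCode' {S : Set ℕ} (h : S.Finite) : ∃ w, finCode w = S := by
  obtain ⟨w, hw⟩ := exists_finCode h.toFinset
  exact ⟨w, by simpa using hw⟩

theorem lt_of_testBit {u m : ℕ} (h : m ∈ finCode u) : m < u :=
  m.lt_two_pow_self.trans_le (Nat.ge_two_pow_of_testBit h)

theorem finite_finCode (u : ℕ) : (finCode u).Finite :=
  (Set.finite_lt_nat u).subset fun _ h => lt_of_testBit h

theorem primrec_bit : PrimrecRel fun (u m : ℕ) => m ∈ finCode u := by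
  have hpow : Primrec₂ ((· ^ ·) : ℕ → ℕ → ℕ) := Primrec₂.unpaired'.1 Nat.Primrec.pow
  have h : PrimrecRel fun (u m : ℕ) => u / 2 ^ m % 2 = 1 :=
    Primrec.eq.comp (Primrec.nat_mod.comp (Primrec.nat_div.comp Primrec.fst
      (hpow.comp (Primrec.const 2) Primrec.snd)) (Primrec.const 2)) (Primrec.const 1)
  refine PrimrecPred.of_eq h fun q => ?_
  simp [finCode, Nat.testBit_eq_decide_div_mod_eq]

/-- `finCode v`, shifted by a primitive recursive map, is contained in `finCode w`. -/
theorem Sig.sub {α : Type} [Primcodable α] {v w : α → ℕ} {φ : α → ℕ → ℕ} (hv : Primrec v)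
    (hw : Primrec w) (hφ : Primrec₂ φ) : Sig fun a => ∀ x ∈ finCode (v a), φ a x ∈ finCode (w a) := by
  have h : Sig fun a => ∀ x < v a, x ∉ finCode (v a) ∨ φ a x ∈ finCode (w a) := by
    refine Sig.all_lt (p := fun a x => x ∉ finCode (v a) ∨ φ a x ∈ finCode (w a)) (Sig.or ?_ ?_) hv
    · exact Sig.prim (PrimrecPred.not (primrec_bit.comp (hv.comp Primrec.fst) Primrec.snd))
    · exact Sig.prim (primrec_bit.comp (hw.comp Primrec.fst) hφ)
  have e : (fun a => ∀ x ∈ finCode (v a), φ a x ∈ finCode (w a)) =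
      fun a => ∀ x < v a, x ∉ finCode (v a) ∨ φ a x ∈ finCode (w a) := by
    funext a
    refine propext ⟨fun h x _ => ?_, fun h x hx => (h x (lt_of_testBit hx)).resolve_left (by simpa)⟩
    by_cases hx : x ∈ finCode (v a)
    · exact Or.inr (h x hx)
    · exact Or.inl hx
  rw [e]; exact h

theorem Sig.ce {α : Type} [Primcodable α] {i n : α → ℕ} (hi : Primrec i) (hn : Primrec n) :
    Sig fun a => n a ∈ ceSet (i a) :=
  sig_ce.comp (Primrec.pair hi hn)

theorem Sig.bit {α : Type} [Primcodable α] {u n : α → ℕ} (hu : Primrec u) (hn : Primrec n) :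
    Sig fun a => n a ∈ finCode (u a) := Sig.prim (primrec_bit.comp hu hn)

theorem Sig.eOp {α : Type} [Primcodable α] {i n w : α → ℕ} (hi : Primrec i) (hn : Primrec n)
    (hw : Primrec w) {φ : α → ℕ → ℕ} (hφ : Primrec₂ φ) :
    Sig fun a => n a ∈ eOp (i a) {x | φ a x ∈ finCode (w a)} := by
  refine Sig.ex (p := fun a u => Nat.pair (n a) u ∈ ceSet (i a) ∧
    finCode u ⊆ {x | φ a x ∈ finCode (w a)}) (Sig.and ?_ ?_)
  · exact Sig.ce (hi.comp Primrec.fst)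
      (Primrec₂.natPair.comp (hn.comp Primrec.fst) Primrec.snd)
  · exact Sig.sub (φ := fun q x => φ q.1 x) Primrec.snd (hw.comp Primrec.fst)
      (hφ.comp (Primrec.fst.comp Primrec.fst) Primrec.snd)

theorem eOp_mono {i : ℕ} {B C : Set ℕ} (h : B ⊆ C) : eOp i B ⊆ eOp i C :=
  fun _ ⟨u, h1, h2⟩ => ⟨u, h1, h2.trans h⟩

/-- Compactness. -/
theorem eOp_fin {i n : ℕ} {B : Set ℕ} (h : n ∈ eOp i B) : ∃ u, finCode u ⊆ B ∧ n ∈ eOp i (finCode u) := by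
  obtain ⟨u, h1, h2⟩ := h
  exact ⟨u, h2, u, h1, subset_rfl⟩

/-- Computable composition of operators. -/
theorem exists_comp : ∃ c : ℕ → ℕ → ℕ, Computable₂ c ∧
    ∀ i j B, eOp (c i j) B = eOp i (eOp j B) := by
  have key : Sig fun q : ℕ × ℕ × ℕ => ∃ u, Nat.pair q.2.1 u ∈ ceSet q.1.unpair.1 ∧
      ∀ m < u, m ∉ finCode u ∨ m ∈ eOp q.1.unpair.2 {x | x ∈ finCode q.2.2} := by
    have h1 : Primrec fun m : ℕ => m.unpair.1 := Primrec.fst.comp Primrec.unpair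
    have h2 : Primrec fun m : ℕ => m.unpair.2 := Primrec.snd.comp Primrec.unpair
    refine Sig.ex (p := fun (q : ℕ × ℕ × ℕ) u => Nat.pair q.2.1 u ∈ ceSet q.1.unpair.1 ∧
      ∀ m < u, m ∉ finCode u ∨ m ∈ eOp q.1.unpair.2 {x | x ∈ finCode q.2.2}) (Sig.and ?_ ?_)
    · exact Sig.ce (h1.comp (Primrec.fst.comp Primrec.fst)) (Primrec₂.natPair.comp
        (Primrec.fst.comp (Primrec.snd.comp Primrec.fst)) Primrec.snd)
    · refine Sig.all_lt (p := fun (q : (ℕ × ℕ × ℕ) × ℕ) m => m ∉ finCode q.2 ∨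
        m ∈ eOp q.1.1.unpair.2 {x | x ∈ finCode q.1.2.2}) (Sig.or ?_ ?_) Primrec.snd
      · exact Sig.prim (PrimrecPred.not (primrec_bit.comp (Primrec.snd.comp Primrec.fst)
          Primrec.snd))
      · exact Sig.eOp (φ := fun _ x => x) (h2.comp (Primrec.fst.comp (Primrec.fst.comp Primrec.fst)))
          Primrec.snd (Primrec.snd.comp (Primrec.snd.comp (Primrec.fst.comp Primrec.fst)))
          Primrec.snd
  obtain ⟨s, hs, hs'⟩ := smn_op (p := fun a n w => ∃ u, Nat.pair n u ∈ ceSet a.unpair.1 ∧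
      ∀ m < u, m ∉ finCode u ∨ m ∈ eOp a.unpair.2 {x | x ∈ finCode w}) key
  refine ⟨fun i j => s (Nat.pair i j), hs.comp Primrec₂.natPair.to_comp, fun i j B => ?_⟩
  ext n
  rw [hs']
  simp only [Nat.unpair_pair, Set.ofPred_mem_eq]
  constructor
  · rintro ⟨w, ⟨u, h1, h2⟩, h3⟩
    exact ⟨u, h1, fun m hm => eOp_mono h3 ((h2 m (lt_of_testBit hm)).resolve_left (by simpa))⟩
  · rintro ⟨u, h1, h2⟩
    have : ∀ m, ∃ w, finCode w ⊆ B ∧ (m ∈ finCode u → m ∈ eOp j (finCode w)) := by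
      intro m
      by_cases hm : m ∈ finCode u
      · obtain ⟨w, h3, h4⟩ := eOp_fin (h2 hm)
        exact ⟨w, h3, fun _ => h4⟩
      · exact ⟨0, by simp [finCode], fun h => absurd h hm⟩
    choose g hg hg' using this
    obtain ⟨w, hw⟩ := exists_finCode' ((finite_finCode u).biUnion fun m _ => finite_finCode (g m))
    refine ⟨w, ⟨u, h1, fun m _ => ?_⟩, ?_⟩
    · by_cases hm : m ∈ finCode u
      · right
        refine eOp_mono ?_ (hg' m hm)
        rw [hw]
        exact Set.subset_biUnion_of_mem (u := fun m => finCode (g m)) hm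
      · exact Or.inl hm
    · rw [hw]
      exact Set.iUnion₂_subset fun m _ => hg m

/-- The set `A` tagged with `k`. -/
def T (k : ℕ) (A : Set ℕ) : Set ℕ :=
  {y | y.unpair.1 = k ∧ (y.unpair.2 = 0 ∨ y.unpair.2 - 1 ∈ A)}

/-- Operators asking a positive question about at most one element. -/
theorem exists_op1 {P Q : ℕ → Prop} {φ : ℕ → ℕ} (hP : PrimrecPred P) (hQ : PrimrecPred Q)
    (hφ : Primrec φ) :
    ∃ i, ∀ B, eOp i B = {n | P n ∧ (Q n ∨ φ n ∈ B)} := by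
  have key : Sig fun q : ℕ × ℕ × ℕ => P q.2.1 ∧ (Q q.2.1 ∨ φ q.2.1 ∈ finCode q.2.2) := by
    have hn : Primrec fun q : ℕ × ℕ × ℕ => q.2.1 := Primrec.fst.comp Primrec.snd
    exact Sig.and (Sig.prim (hP.comp hn)) (Sig.or (Sig.prim (hQ.comp hn))
      (Sig.bit (Primrec.snd.comp Primrec.snd) (hφ.comp hn)))
  obtain ⟨s, -, hs⟩ := smn_op (p := fun _ n w => P n ∧ (Q n ∨ φ n ∈ finCode w)) key
  refine ⟨s 0, fun B => ?_⟩
  ext n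
  rw [hs]
  constructor
  · rintro ⟨w, ⟨h1, h2⟩, h3⟩
    exact ⟨h1, h2.imp id fun h => h3 h⟩
  · rintro ⟨h1, h2 | h2⟩
    · exact ⟨0, ⟨h1, Or.inl h2⟩, by simp [finCode]⟩
    · obtain ⟨w, hw⟩ := exists_finCode {φ n}
      refine ⟨w, ⟨h1, Or.inr ?_⟩, ?_⟩ <;> rw [hw] <;> simpa

theorem exists_alpha : ∃ i j, ∀ A, EEquivVia A (T 0 A) i j := by
  have h1 : Primrec fun m : ℕ => m.unpair.1 := Primrec.fst.comp Primrec.unpair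
  have h2 : Primrec fun m : ℕ => m.unpair.2 := Primrec.snd.comp Primrec.unpair
  obtain ⟨i, hi⟩ := exists_op1 (P := fun n => n = n) (Q := fun n => n = n + 1)
    (φ := fun n => Nat.pair 0 (n + 1)) (Primrec.eq.comp Primrec.id Primrec.id)
    (Primrec.eq.comp Primrec.id Primrec.succ)
    (Primrec₂.natPair.comp (Primrec.const 0) Primrec.succ)
  obtain ⟨j, hj⟩ := exists_op1 (P := fun n => n.unpair.1 = 0) (Q := fun n => n.unpair.2 = 0)
    (φ := fun n => n.unpair.2 - 1) (Primrec.eq.comp h1 (Primrec.const 0))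
    (Primrec.eq.comp h2 (Primrec.const 0)) (Primrec.nat_sub.comp h2 (Primrec.const 1))
  refine ⟨i, j, fun A => ⟨?_, ?_⟩⟩
  · unfold ELeVia
    rw [hi]; ext n; simp [T]
  · unfold ELeVia
    rw [hj]; rfl

theorem exists_beta : ∃ i j, ∀ k A, EEquivVia (T k A) (T (k + 1) A) i j := by
  have h1 : Primrec fun m : ℕ => m.unpair.1 := Primrec.fst.comp Primrec.unpair
  have h2 : Primrec fun m : ℕ => m.unpair.2 := Primrec.snd.comp Primrec.unpair
  obtain ⟨i, hi⟩ := exists_op1 (P := fun n => n = n) (Q := fun n => n = n + 1)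
    (φ := fun n => Nat.pair (n.unpair.1 + 1) n.unpair.2) (Primrec.eq.comp Primrec.id Primrec.id)
    (Primrec.eq.comp Primrec.id Primrec.succ)
    (Primrec₂.natPair.comp (Primrec.succ.comp h1) h2)
  obtain ⟨j, hj⟩ := exists_op1 (P := fun n => ¬ n.unpair.1 = 0) (Q := fun n => n = n + 1)
    (φ := fun n => Nat.pair (n.unpair.1 - 1) n.unpair.2)
    (PrimrecPred.not (Primrec.eq.comp h1 (Primrec.const 0)))
    (Primrec.eq.comp Primrec.id Primrec.succ)
    (Primrec₂.natPair.comp (Primrec.nat_sub.comp h1 (Primrec.const 1)) h2)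
  refine ⟨i, j, fun k A => ⟨?_, ?_⟩⟩
  · unfold ELeVia
    rw [hi]; ext n; simp [T]
  · unfold ELeVia
    rw [hj]; ext n
    simp only [T, Set.mem_ofPred_eq, Nat.unpair_pair]
    constructor
    · rintro ⟨h, h'⟩
      exact ⟨by omega, Or.inr ⟨by omega, h'⟩⟩
    · rintro ⟨h, h' | ⟨h', h''⟩⟩
      · omega
      · exact ⟨by omega, h''⟩

/-- The tagged application operator. -/
theorem exists_app {g : ℕ → ℕ} (hg : Primrec g) : ∃ i, ∀ k A, eOp i (T k A) = T k (eOp (g k) A) := by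
  have h1 : Primrec fun m : ℕ => m.unpair.1 := Primrec.fst.comp Primrec.unpair
  have h2 : Primrec fun m : ℕ => m.unpair.2 := Primrec.snd.comp Primrec.unpair
  have key : Sig fun q : ℕ × ℕ × ℕ => Nat.pair q.2.1.unpair.1 0 ∈ finCode q.2.2 ∧
      (q.2.1.unpair.2 = 0 ∨ q.2.1.unpair.2 - 1 ∈ eOp (g q.2.1.unpair.1)
        {x | Nat.pair q.2.1.unpair.1 (x + 1) ∈ finCode q.2.2}) := by
    have hn : Primrec fun q : ℕ × ℕ × ℕ => q.2.1 := Primrec.fst.comp Primrec.snd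
    have hw : Primrec fun q : ℕ × ℕ × ℕ => q.2.2 := Primrec.snd.comp Primrec.snd
    refine Sig.and (Sig.bit hw (Primrec₂.natPair.comp (h1.comp hn) (Primrec.const 0)))
      (Sig.or (Sig.prim (Primrec.eq.comp (h2.comp hn) (Primrec.const 0))) ?_)
    exact Sig.eOp (φ := fun (q : ℕ × ℕ × ℕ) x => Nat.pair q.2.1.unpair.1 (x + 1))
      (hg.comp (h1.comp hn)) (Primrec.nat_sub.comp (h2.comp hn) (Primrec.const 1)) hw
      (Primrec₂.natPair.comp ((h1.comp hn).comp Primrec.fst) (Primrec.succ.comp Primrec.snd))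
  obtain ⟨s, -, hs⟩ := smn_op (p := fun _ n w => Nat.pair n.unpair.1 0 ∈ finCode w ∧
      (n.unpair.2 = 0 ∨ n.unpair.2 - 1 ∈ eOp (g n.unpair.1)
        {x | Nat.pair n.unpair.1 (x + 1) ∈ finCode w})) key
  refine ⟨s 0, fun k A => ?_⟩
  ext n
  rw [hs]
  constructor
  · rintro ⟨w, ⟨h3, h4⟩, h5⟩
    have h6 := h5 h3
    simp only [T, Set.mem_ofPred_eq, Nat.unpair_pair] at h6
    refine ⟨h6.1, h4.imp id fun h => ?_⟩
    rw [← h6.1]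
    refine eOp_mono ?_ h
    intro x hx
    have := h5 hx
    simpa [T, h6.1] using this
  · rintro ⟨rfl, h⟩
    rcases h with h | h
    · obtain ⟨w, hw⟩ := exists_finCode {Nat.pair n.unpair.1 0}
      refine ⟨w, ⟨by rw [hw]; simp, Or.inl h⟩, ?_⟩
      rw [hw]; simp [T]
    · obtain ⟨u, hu, hu'⟩ := eOp_fin h
      obtain ⟨w, hw⟩ := exists_finCode' (((finite_finCode u).image
        fun x => Nat.pair n.unpair.1 (x + 1)).insert (Nat.pair n.unpair.1 0))
      refine ⟨w, ⟨by rw [hw]; simp, Or.inr (eOp_mono ?_ hu')⟩, ?_⟩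
      · intro x hx
        rw [hw]
        exact Or.inr ⟨x, hx, rfl⟩
      · rw [hw]
        rintro y (rfl | ⟨x, hx, rfl⟩)
        · simp [T]
        · simpa [T] using hu hx

theorem exists_gamma : ∃ a b, ∀ A B i j, EEquivVia A B i j →
    EEquivVia (T (Nat.pair i j) A) (T (Nat.pair i j) B) a b := by
  obtain ⟨a, ha⟩ := exists_app (g := fun k => k.unpair.1) (Primrec.fst.comp Primrec.unpair)
  obtain ⟨b, hb⟩ := exists_app (g := fun k => k.unpair.2) (Primrec.snd.comp Primrec.unpair)
  refine ⟨a, b, fun A B i j h => ⟨?_, ?_⟩⟩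
  · unfold ELeVia
    rw [ha, Nat.unpair_pair, ← h.1]
  · unfold ELeVia
    rw [hb, Nat.unpair_pair, ← h.2]

theorem EEquivVia.to {A B : Set ℕ} {i j : ℕ} (h : EEquivVia A B i j) : EEquiv A B :=
  ⟨⟨i, h.1⟩, ⟨j, h.2⟩⟩

theorem main (D : Set (Set ℕ))
    (hD : ∀ A ∈ D, ∀ B : Set ℕ, EEquiv A B → B ∈ D)
    (f : Set ℕ → Set ℕ) (hf : UniformlyEInvariantOn D f) :
    ∃ v : ℕ → ℕ, Computable v ∧ IsUniformityOn D f v := by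
  obtain ⟨u, hu⟩ := hf
  obtain ⟨c, hc, hc'⟩ := exists_comp
  obtain ⟨a1, a2, ha⟩ := exists_alpha
  obtain ⟨b1, b2, hb⟩ := exists_beta
  obtain ⟨g1, g2, hg⟩ := exists_gamma
  have hT : ∀ A ∈ D, ∀ k, T k A ∈ D := by
    intro A hA k
    induction k with
    | zero => exact hD A hA _ (EEquivVia.to (ha A))
    | succ k ih => exact hD _ ih _ (EEquivVia.to (hb k A))
  obtain ⟨α1, α2, hα⟩ : ∃ i j, ∀ A ∈ D, EEquivVia (f A) (f (T 0 A)) i j :=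
    ⟨_, _, fun A hA => hu A hA _ (hT A hA 0) _ _ (ha A)⟩
  obtain ⟨β1, β2, hβ⟩ : ∃ i j, ∀ A ∈ D, ∀ k, EEquivVia (f (T k A)) (f (T (k + 1) A)) i j :=
    ⟨_, _, fun A hA k => hu _ (hT A hA k) _ (hT A hA (k + 1)) _ _ (hb k A)⟩
  obtain ⟨γ1, γ2, hγ⟩ : ∃ a b, ∀ A ∈ D, ∀ B ∈ D, ∀ i j, EEquivVia A B i j →
      EEquivVia (f (T (Nat.pair i j) A)) (f (T (Nat.pair i j) B)) a b :=
    ⟨_, _, fun A hA B hB i j h => hu _ (hT A hA _) _ (hT B hB _) _ _ (hg A B i j h)⟩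
  let F : ℕ → ℕ := fun k => Nat.rec α1 (fun _ r => c r β1) k
  let G : ℕ → ℕ := fun k => Nat.rec α2 (fun _ r => c β2 r) k
  have hF : Computable F := Computable.nat_rec Computable.id (Computable.const α1)
    (hc.comp (Computable.snd.comp Computable.snd) (Computable.const β1)).to₂
  have hG : Computable G := Computable.nat_rec Computable.id (Computable.const α2)
    (hc.comp (Computable.const β2) (Computable.snd.comp Computable.snd)).to₂
  have hF' : ∀ A ∈ D, ∀ k, f A = eOp (F k) (f (T k A)) := by
    intro A hA k
    induction k with
    | zero => exact (hα A hA).1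
    | succ k ih =>
      change f A = eOp (c (F k) β1) _
      rw [hc', ← (hβ A hA k).1]
      exact ih
  have hG' : ∀ A ∈ D, ∀ k, f (T k A) = eOp (G k) (f A) := by
    intro A hA k
    induction k with
    | zero => exact (hα A hA).2
    | succ k ih =>
      change _ = eOp (c β2 (G k)) _
      rw [hc', ← ih]
      exact (hβ A hA k).2
  refine ⟨fun k => Nat.pair (c (F k) (c γ1 (G k))) (c (F k) (c γ2 (G k))), ?_, ?_⟩
  · exact Primrec₂.natPair.to_comp.comp
      (hc.comp hF (hc.comp (Computable.const γ1) hG))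
      (hc.comp hF (hc.comp (Computable.const γ2) hG))
  · intro A hA B hB i j h
    simp only [Nat.unpair_pair]
    have hh := hγ A hA B hB i j h
    constructor
    · unfold ELeVia
      rw [hc', hc', ← hG' B hB, ← hh.1]
      exact hF' A hA _
    · unfold ELeVia
      rw [hc', hc', ← hG' A hA, ← hh.2]
      exact hF' B hB _

end CU

/-- If `X ⊆ P(ℕ)` is closed under enumeration equivalence and `f : X → P(ℕ)`
is uniformly e-invariant, then `f` has a computable uniformity function. -/
theorem computable_uniformity (D : Set (Set ℕ))
    (hD : ∀ A ∈ D, ∀ B : Set ℕ, EEquiv A B → B ∈ D)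
    (f : Set ℕ → Set ℕ) (hf : UniformlyEInvariantOn D f) :
    ∃ v : ℕ → ℕ, Computable v ∧ IsUniformityOn D f v := by
  exact CU.main D hD f hf
end
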